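/- For any instance with exactly 3 agents whose true valuations are nonnegative monotone subadditive set functions, and any bid profile b = (b_1, b_2, b_3) in which agent i's bid b_i is a best response to the other agents' bids, the allocation produced by Preferred-Item-E-C-E on b is (1/3)-EF1 from agent i's perspective with respect to agent i's true valuation. -/

import Mathlib

/-!
Formalization of the strategic Envy-Cycle-Elimination (E-C-E) setting with monotone
subadditive (set-function) valuations.

There are `n` agents and `m` goods (`Fin m`), with the predefined ordering of agents
and goods given by the orders on `Fin n` and `Fin m`.  A bid consists of a reported
nonnegative monotone subadditive set function together with a preference list (a
permutation of the goods); the envy graph is defined using the reported set-function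
values.  E-C-E starts from empty bundles and, while unallocated goods remain, selects
a source of the envy graph will (envious sources have priority, ties broken by the
predefined agent ordering), adds to that agent's bundle the earliest unallocated good
in her preference list, and then repeatedly eliminates envy cycles, in a fixed order,
until the envy graph has a source.  This is the Preferred-Item-E-C-E variant.
-/

open scoped Classical
open Finset

/-- A bid of an agent in the subadditive setting: a reported nonnegative monotone
subadditive set function together with a preference list, a permutation of the
goods. -/
structure SetBid (m : ℕ) where
  val : Finset (Fin m) → ℝ
  nonneg : ∀ S, 0 ≤ val S
  mono : ∀ S T, val S ≤ val (S ∪ T)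
  subadd : ∀ S T, val (S ∪ T) ≤ val S + val T
  pref : Equiv.Perm (Fin m)

namespace SubECE

variable {n m : ℕ}

/-- Envy-graph edge: agent `i` envies agent `j` (w.r.t. the reported set-function
valuations) under the partial allocation `P`. -/
def envies (b : Fin n → SetBid m) (P : Fin n → Finset (Fin m)) (i j : Fin n) : Prop :=
  (b i).val (P i) < (b i).val (P j)

/-- The sources (vertices of in-degree 0) of the envy graph. -/
noncomputable def sources (b : Fin n → SetBid m) (P : Fin n → Finset (Fin m)) :
    Finset (Fin n) :=
  univ.filter fun i => ∀ j, ¬ envies b P j i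

/-- The envy cycles of the current envy graph, represented as cyclic permutations `σ`
of the agents such that every agent moved by `σ` envies her image under `σ`. -/
noncomputable def cycleSet (b : Fin n → SetBid m) (P : Fin n → Finset (Fin m)) :
    Finset (Equiv.Perm (Fin n)) :=
  univ.filter fun σ => σ.IsCycle ∧ ∀ i, σ i ≠ i → envies b P i (σ i)

/-- A fixed enumeration of the permutations of the agents, providing the fixed
(lexicographic) order in which envy cycles are eliminated. -/
noncomputable def permIdx (n : ℕ) :
    Equiv.Perm (Fin n) ≃ Fin (Fintype.card (Equiv.Perm (Fin n))) :=
  Fintype.equivFin _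

/-- Eliminate one envy cycle (the first one in the fixed order): every agent on the
cycle receives the bundle of the agent she envies. -/
noncomputable def elimOnce (b : Fin n → SetBid m) (P : Fin n → Finset (Fin m)) :
    Fin n → Finset (Fin m) :=
  if h : (cycleSet b P).Nonempty then
    let σ := (permIdx n).symm (((cycleSet b P).image (permIdx n)).min' (h.image _))
    fun i => P (σ i)
  else P

/-- Repeatedly eliminate envy cycles until the envy graph has a source. -/
noncomputable def resolve (b : Fin n → SetBid m) :
    ℕ → (Fin n → Finset (Fin m)) → Fin n → Finset (Fin m)
  | 0, P => P
  | fuel + 1, P => if (sources b P).Nonempty then P else resolve b fuel (elimOnce b P)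

/-- Source selection: among multiple sources, those having at least one outgoing envy
edge have priority, ties broken by the predefined ordering of the agents. -/
noncomputable def priAgent (b : Fin n → SetBid m) (P : Fin n → Finset (Fin m)) :
    Option (Fin n) :=
  if h' : ((sources b P).filter fun i => ∃ j, envies b P i j).Nonempty then
    some (((sources b P).filter fun i => ∃ j, envies b P i j).min' h')
  else if h : (sources b P).Nonempty then some ((sources b P).min' h) else none

/-- The earliest unallocated good in the preference list `pref`. -/
noncomputable def preferredItem (pref : Equiv.Perm (Fin m)) (R : Finset (Fin m))
    (hR : R.Nonempty) : Fin m :=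
  pref.symm ((R.image pref).min' (hR.image _))

/-- The state (current partial allocation, remaining unallocated goods) of the
Preferred-Item-E-C-E run after a given number of steps. -/
noncomputable def stateECE (b : Fin n → SetBid m) :
    ℕ → (Fin n → Finset (Fin m)) × Finset (Fin m)
  | 0 => (fun _ => ∅, univ)
  | k + 1 =>
    let s := stateECE b k
    if hR : s.2.Nonempty then
      match priAgent b s.1 with
      | none => s
      | some i =>
        let g := preferredItem (b i).pref s.2 hR
        (resolve b (n * n + 1) (fun j => if j = i then insert g (s.1 j) else s.1 j),
          s.2.erase g)
    else s

/-- Preferred-Item-E-C-E with reported set-function valuations: envious sources have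
priority, and the chosen agent receives the earliest unallocated good in her
preference list. -/
noncomputable def PreferredItemECE (b : Fin n → SetBid m) : Fin n → Finset (Fin m) :=
  (stateECE b m).1

/-- The allocation `A` is `α`-EF1 from agent `i`'s perspective w.r.t. the set-function
valuation `v`: for every agent `j` with nonempty bundle there is a good `g ∈ A j` with
`v (A i) ≥ α · v (A j \ {g})`. -/
def EF1From (α : ℝ) (v : Finset (Fin m) → ℝ) (A : Fin n → Finset (Fin m))
    (i : Fin n) : Prop :=
  ∀ j : Fin n, (A j).Nonempty → ∃ g ∈ A j, α * v ((A j).erase g) ≤ v (A i)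

/-- Agent `i`'s bid in the profile `b` is a best response to the others' bids, w.r.t.
her true set-function valuation `v`: no alternative bid gives her a bundle of strictly
larger true value. -/
def BestResponse (Mech : (Fin n → SetBid m) → Fin n → Finset (Fin m))
    (v : Finset (Fin m) → ℝ) (b : Fin n → SetBid m) (i : Fin n) : Prop :=
  ∀ b' : SetBid m, v (Mech (Function.update b i b') i) ≤ v (Mech b i)

end SubECE

open SubECE

namespace SubECE

variable {m : ℕ}

section Mechanics

/-- A configuration: a partial allocation with the set of unallocated goods. -/
abbrev Config (m : ℕ) := (Fin 3 → Finset (Fin m)) × Finset (Fin m)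

/-- Add the good `g` to the bundle of agent `q`. -/
noncomputable def give (P : Fin 3 → Finset (Fin m)) (q : Fin 3) (g : Fin m) :
    Fin 3 → Finset (Fin m) :=
  fun j => if j = q then insert g (P j) else P j

/-- The configuration before any good is allocated. -/
def initial (m : ℕ) : Config m := (fun _ => ∅, univ)

/-- One small step of the run: add a good to the bundle of the selected source, or
eliminate one cycle if there is no source. -/
noncomputable def step (b : Fin 3 → SetBid m) (s : Config m) : Config m :=
  if (sources b s.1).Nonempty then
    if hR : s.2.Nonempty then
      match priAgent b s.1 with
      | none => s
      | some q =>
        (give s.1 q (preferredItem (b q).pref s.2 hR),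
          s.2.erase (preferredItem (b q).pref s.2 hR))
    else s
  else (elimOnce b s.1, s.2)

theorem mem_sources {b : Fin 3 → SetBid m} {P : Fin 3 → Finset (Fin m)} {q : Fin 3} :
    q ∈ sources b P ↔ ∀ j, ¬ envies b P j q := by
  simp [sources]

theorem cycleSet_nonempty {b : Fin 3 → SetBid m} {P : Fin 3 → Finset (Fin m)}
    (h : ¬ (sources b P).Nonempty) : (cycleSet b P).Nonempty := by
  have h1 : ∀ k, ∃ j, envies b P j k := by
    intro k
    by_contra hk
    push Not at hk
    exact h ⟨k, mem_sources.2 hk⟩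
  choose p hp using h1
  have hne : ∀ k, p k ≠ k := by
    intro k hk
    have := hp k
    rw [hk] at this
    exact lt_irrefl _ this
  have key : ∀ p : Fin 3 → Fin 3, (∀ k, p k ≠ k) →
      (∃ a c, a ≠ c ∧ p a = c ∧ p c = a) ∨ (∀ i, p (finRotate 3 i) = i) ∨
        (∀ i, p ((finRotate 3)⁻¹ i) = i) := by
    decide
  rcases key p hne with ⟨a, c, hac, h1, h2⟩ | h1 | h1
  · refine ⟨Equiv.swap a c, ?_⟩
    simp only [cycleSet, mem_filter, mem_univ, true_and]
    refine ⟨Equiv.Perm.isCycle_swap hac, fun i hi => ?_⟩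
    by_cases hia : i = a
    · subst hia
      rw [Equiv.swap_apply_left]
      simpa [h2] using hp c
    · by_cases hic : i = c
      · subst hic
        rw [Equiv.swap_apply_right]
        simpa [h1] using hp a
      · exact absurd (Equiv.swap_apply_of_ne_of_ne hia hic) hi
  · refine ⟨finRotate 3, ?_⟩
    simp only [cycleSet, mem_filter, mem_univ, true_and]
    refine ⟨isCycle_finRotate, fun i _ => ?_⟩
    have := hp (finRotate 3 i)
    rwa [h1] at this
  · refine ⟨(finRotate 3)⁻¹, ?_⟩
    simp only [cycleSet, mem_filter, mem_univ, true_and]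
    refine ⟨isCycle_finRotate.inv, fun i _ => ?_⟩
    have := hp ((finRotate 3)⁻¹ i)
    rwa [h1] at this

/-- The cycle eliminated first. -/
theorem exists_elimOnce {b : Fin 3 → SetBid m} {P : Fin 3 → Finset (Fin m)}
    (h : (cycleSet b P).Nonempty) :
    ∃ σ ∈ cycleSet b P, (∀ τ ∈ cycleSet b P, permIdx 3 σ ≤ permIdx 3 τ) ∧
      elimOnce b P = fun j => P (σ j) := by
  have h2 := ((cycleSet b P).image (permIdx 3)).min'_mem (h.image _)
  obtain ⟨σ, hσ, hσ2⟩ := mem_image.1 h2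
  refine ⟨σ, hσ, fun τ hτ => ?_, ?_⟩
  · rw [hσ2]
    exact min'_le _ _ (mem_image_of_mem _ hτ)
  · unfold elimOnce
    rw [dif_pos h]
    simp only [← hσ2, Equiv.symm_apply_apply]

theorem exists_elimOnce_of_no_source {b : Fin 3 → SetBid m} {P : Fin 3 → Finset (Fin m)}
    (h : ¬ (sources b P).Nonempty) :
    ∃ σ : Equiv.Perm (Fin 3), σ ≠ 1 ∧ (∀ j, σ j ≠ j → envies b P j (σ j)) ∧
      elimOnce b P = fun j => P (σ j) := by
  obtain ⟨σ, hσ, -, h2⟩ := exists_elimOnce (cycleSet_nonempty h)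
  simp only [cycleSet, mem_filter, mem_univ, true_and] at hσ
  exact ⟨σ, hσ.1.ne_one, hσ.2, h2⟩

/-- The number of edges of the envy graph. -/
noncomputable def edgeCount (b : Fin 3 → SetBid m) (P : Fin 3 → Finset (Fin m)) : ℕ :=
  ∑ j, #(univ.filter fun k => envies b P j k)

theorem edgeCount_elimOnce_lt {b : Fin 3 → SetBid m} {P : Fin 3 → Finset (Fin m)}
    (h : ¬ (sources b P).Nonempty) : edgeCount b (elimOnce b P) < edgeCount b P := by
  obtain ⟨σ, hσ1, hσ, he⟩ := exists_elimOnce_of_no_source h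
  rw [he]
  have hle : ∀ j, (b j).val (P j) ≤ (b j).val (P (σ j)) := by
    intro j
    by_cases hj : σ j = j
    · rw [hj]
    · exact (hσ j hj).le
  have hcard : ∀ j, #(univ.filter fun k => envies b (fun j => P (σ j)) j k) =
      #(univ.filter fun k => (b j).val (P (σ j)) < (b j).val (P k)) := by
    intro j
    refine card_bij (fun k _ => σ k) ?_ ?_ ?_
    · intro k hk
      exact mem_filter.2 ⟨mem_univ _, (mem_filter.1 hk).2⟩
    · intro k _ l _ hkl
      exact σ.injective hkl
    · intro k hk
      refine ⟨σ.symm k, mem_filter.2 ⟨mem_univ _, ?_⟩, by simp⟩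
      simpa [envies] using (mem_filter.1 hk).2
  unfold edgeCount
  obtain ⟨j0, hj0⟩ : ∃ j, σ j ≠ j := by
    by_contra hcon
    push Not at hcon
    exact hσ1 (Equiv.ext hcon)
  have hss : ∀ j, (univ.filter fun k => (b j).val (P (σ j)) < (b j).val (P k)) ⊆
      univ.filter fun k => envies b P j k := fun j k hk =>
    mem_filter.2 ⟨mem_univ _, lt_of_le_of_lt (hle j) (mem_filter.1 hk).2⟩
  refine sum_lt_sum (fun j _ => ?_) ⟨j0, mem_univ _, ?_⟩
  · rw [hcard]
    exact card_le_card (hss j)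
  · rw [hcard]
    refine card_lt_card ⟨hss j0, fun hsub => ?_⟩
    have := hsub (mem_filter.2 ⟨mem_univ _, hσ j0 hj0⟩)
    exact lt_irrefl _ (mem_filter.1 this).2

theorem sources_resolve_nonempty {b : Fin 3 → SetBid m} (fuel : ℕ)
    (P : Fin 3 → Finset (Fin m)) (h : edgeCount b P < fuel) :
    (sources b (resolve b fuel P)).Nonempty := by
  induction fuel generalizing P with
  | zero => omega
  | succ k ih =>
    unfold resolve
    split_ifs with hs
    · exact hs
    · exact ih _ (by have := edgeCount_elimOnce_lt hs; omega)

theorem edgeCount_lt (b : Fin 3 → SetBid m) (P : Fin 3 → Finset (Fin m)) :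
    edgeCount b P < 3 * 3 + 1 := by
  have : edgeCount b P ≤ ∑ _j : Fin 3, 3 := by
    refine sum_le_sum fun j _ => ?_
    exact (card_le_univ _).trans (by simp)
  simp at this
  omega

theorem exists_iterate_step_eq_resolve (b : Fin 3 → SetBid m) (fuel : ℕ)
    (P : Fin 3 → Finset (Fin m)) (R : Finset (Fin m)) :
    ∃ k, (step b)^[k] (P, R) = (resolve b fuel P, R) := by
  induction fuel generalizing P with
  | zero => exact ⟨0, rfl⟩
  | succ f ih =>
    unfold resolve
    split_ifs with hs
    · exact ⟨0, rfl⟩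
    · obtain ⟨k, hk⟩ := ih (elimOnce b P)
      refine ⟨k + 1, ?_⟩
      rw [Function.iterate_succ_apply, ← hk]
      simp [step, hs]

theorem priAgent_mem {b : Fin 3 → SetBid m} {P : Fin 3 → Finset (Fin m)} {q : Fin 3}
    (h : priAgent b P = some q) : q ∈ sources b P := by
  unfold priAgent at h
  split_ifs at h with h1 h2
  · have := min'_mem _ h1
    simp only [Option.some.injEq] at h
    rw [h] at this
    exact (mem_filter.1 this).1
  · have := min'_mem _ h2
    simp only [Option.some.injEq] at h
    rwa [h] at this

theorem exists_priAgent {b : Fin 3 → SetBid m} {P : Fin 3 → Finset (Fin m)}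
    (h : (sources b P).Nonempty) : ∃ q, priAgent b P = some q := by
  unfold priAgent
  split_ifs
  · exact ⟨_, rfl⟩
  · exact ⟨_, rfl⟩

theorem priAgent_eq {b : Fin 3 → SetBid m} {P : Fin 3 → Finset (Fin m)} {q : Fin 3}
    (hq : q ∈ sources b P)
    (h : ∀ s ∈ sources b P, s ≠ q →
      (∃ j, envies b P q j) ∧ ((∀ j, ¬ envies b P s j) ∨ q < s)) :
    priAgent b P = some q := by
  unfold priAgent
  split_ifs with h1 h2
  · congr 1
    have hm := min'_mem _ h1
    by_contra hne
    have hm' := mem_filter.1 hm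
    obtain ⟨he, hor⟩ := h _ hm'.1 hne
    rcases hor with hor | hor
    · obtain ⟨j, hj⟩ := hm'.2
      exact hor j hj
    · exact absurd (min'_le _ q (mem_filter.2 ⟨hq, he⟩)) (not_le.2 hor)
  · congr 1
    have hm := min'_mem _ h2
    by_contra hne
    obtain ⟨he, -⟩ := h _ hm hne
    exact h1 ⟨q, mem_filter.2 ⟨hq, he⟩⟩
  · exact absurd ⟨q, hq⟩ h2

theorem preferredItem_mem (p : Equiv.Perm (Fin m)) (R : Finset (Fin m)) (hR : R.Nonempty) :
    preferredItem p R hR ∈ R := by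
  have h := min'_mem (R.image p) (hR.image _)
  obtain ⟨x, hx, hx2⟩ := mem_image.1 h
  unfold preferredItem
  rw [← hx2]
  simpa using hx

theorem preferredItem_eq {p : Equiv.Perm (Fin m)} {R : Finset (Fin m)} (hR : R.Nonempty)
    {g : Fin m} (hg : g ∈ R) (h : ∀ y ∈ R, p g ≤ p y) : preferredItem p R hR = g := by
  unfold preferredItem
  rw [Equiv.symm_apply_eq]
  refine le_antisymm (min'_le _ _ (mem_image_of_mem _ hg)) (le_min' _ _ _ fun y hy => ?_)
  obtain ⟨x, hx, rfl⟩ := mem_image.1 hy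
  exact h x hx

theorem step_add {b : Fin 3 → SetBid m} {s : Config m} {q : Fin 3}
    (hq : priAgent b s.1 = some q) (hR : s.2.Nonempty) :
    step b s = (give s.1 q (preferredItem (b q).pref s.2 hR),
      s.2.erase (preferredItem (b q).pref s.2 hR)) := by
  unfold step
  rw [if_pos ⟨q, priAgent_mem hq⟩, dif_pos hR]
  simp only [hq]

theorem step_elim {b : Fin 3 → SetBid m} {s : Config m}
    (h : ¬ (sources b s.1).Nonempty) : step b s = (elimOnce b s.1, s.2) := by
  unfold step
  rw [if_neg h]

theorem step_final {b : Fin 3 → SetBid m} {s : Config m}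
    (h : (sources b s.1).Nonempty) (hR : s.2 = ∅) : step b s = s := by
  unfold step
  rw [if_pos h, dif_neg (by simp [hR])]

theorem exists_iterate_step_eq_stateECE (b : Fin 3 → SetBid m) (k : ℕ) (hk : k ≤ m) :
    (∃ N, (step b)^[N] (initial m) = stateECE b k) ∧
      (sources b (stateECE b k).1).Nonempty ∧ #(stateECE b k).2 = m - k := by
  induction k with
  | zero =>
    refine ⟨⟨0, rfl⟩, ⟨0, mem_sources.2 fun j => ?_⟩, by simp [stateECE]⟩
    simp [envies, stateECE]
  | succ k ih =>
    obtain ⟨⟨N, hN⟩, hs, hc⟩ := ih (by omega)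
    have hR : (stateECE b k).2.Nonempty := by
      rw [← card_pos]
      omega
    obtain ⟨q, hq⟩ := exists_priAgent hs
    have he : stateECE b (k + 1) =
        (resolve b (3 * 3 + 1) (give (stateECE b k).1 q
          (preferredItem (b q).pref (stateECE b k).2 hR)),
          (stateECE b k).2.erase (preferredItem (b q).pref (stateECE b k).2 hR)) := by
      rw [stateECE]
      simp only [dif_pos hR, hq]
      rfl
    rw [he]
    refine ⟨?_, sources_resolve_nonempty _ _ (edgeCount_lt _ _), ?_⟩
    · obtain ⟨k1, hk1⟩ := exists_iterate_step_eq_resolve b (3 * 3 + 1)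
        (give (stateECE b k).1 q (preferredItem (b q).pref (stateECE b k).2 hR))
        ((stateECE b k).2.erase (preferredItem (b q).pref (stateECE b k).2 hR))
      refine ⟨k1 + (N + 1), ?_⟩
      rw [Function.iterate_add_apply, Function.iterate_succ_apply', hN, step_add hq hR, hk1]
    · rw [card_erase_of_mem (preferredItem_mem _ _ _)]
      omega

/-- The small-step run ends with the outcome of the mechanism. -/
theorem exists_iterate_step_eq_outcome (b : Fin 3 → SetBid m) :
    (∃ N, (step b)^[N] (initial m) = (PreferredItemECE b, ∅)) ∧
      (sources b (PreferredItemECE b)).Nonempty := by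
  obtain ⟨⟨N, hN⟩, hs, hc⟩ := exists_iterate_step_eq_stateECE b m le_rfl
  refine ⟨⟨N, ?_⟩, hs⟩
  rw [hN]
  have : (stateECE b m).2 = ∅ := by
    rw [← card_eq_zero]
    omega
  exact Prod.ext rfl this

end Mechanics

section Reachability

theorem sources_congr {b b' : Fin 3 → SetBid m} {P : Fin 3 → Finset (Fin m)}
    (h : envies b P = envies b' P) : sources b P = sources b' P := by
  unfold sources
  rw [h]

theorem cycleSet_congr {b b' : Fin 3 → SetBid m} {P : Fin 3 → Finset (Fin m)}
    (h : envies b P = envies b' P) : cycleSet b P = cycleSet b' P := by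
  unfold cycleSet
  rw [h]

theorem elimOnce_congr {b b' : Fin 3 → SetBid m} {P : Fin 3 → Finset (Fin m)}
    (h : envies b P = envies b' P) : elimOnce b P = elimOnce b' P := by
  unfold elimOnce
  simp only [cycleSet_congr h]

theorem priAgent_congr {b b' : Fin 3 → SetBid m} {P : Fin 3 → Finset (Fin m)}
    (h : envies b P = envies b' P) : priAgent b P = priAgent b' P := by
  unfold priAgent
  rw [sources_congr h, h]

/-- The bid reporting (a shifted copy of) the monotone function `f`. -/
noncomputable def mkBid (f : Finset (Fin m) →o ℝ) (p : Equiv.Perm (Fin m)) : SetBid m where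
  val S := (f S - f ∅) + (f univ - f ∅)
  nonneg S := by
    have h1 := f.mono (empty_subset S)
    have h2 := f.mono (empty_subset (univ : Finset (Fin m)))
    linarith
  mono S T := by
    have h1 := f.mono (subset_union_left : S ⊆ S ∪ T)
    linarith
  subadd S T := by
    have h1 := f.mono (subset_univ (S ∪ T))
    have h2 := f.mono (empty_subset S)
    have h3 := f.mono (empty_subset T)
    linarith
  pref := p

/-- The profile in which agent `i` reports `f`, with preference list `p`. -/
noncomputable def withBid (b : Fin 3 → SetBid m) (i : Fin 3) (f : Finset (Fin m) →o ℝ)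
    (p : Equiv.Perm (Fin m)) : Fin 3 → SetBid m :=
  Function.update b i (mkBid f p)

variable {b : Fin 3 → SetBid m} {i : Fin 3} {f f' : Finset (Fin m) →o ℝ}

theorem envies_withBid_self {p : Equiv.Perm (Fin m)} {P : Fin 3 → Finset (Fin m)} {k : Fin 3} :
    envies (withBid b i f p) P i k ↔ f (P i) < f (P k) := by
  simp [envies, withBid, mkBid]

theorem envies_withBid_of_ne {p : Equiv.Perm (Fin m)} {P : Fin 3 → Finset (Fin m)}
    {j k : Fin 3} (hj : j ≠ i) :
    envies (withBid b i f p) P j k ↔ (b j).val (P j) < (b j).val (P k) := by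
  simp [envies, withBid, hj]

theorem envies_withBid_congr {p p' : Equiv.Perm (Fin m)} {P : Fin 3 → Finset (Fin m)}
    (h : ∀ k, f (P i) < f (P k) ↔ f' (P i) < f' (P k)) :
    envies (withBid b i f p) P = envies (withBid b i f' p') P := by
  funext j k
  by_cases hj : j = i
  · subst hj
    simp only [envies_withBid_self, h]
  · simp only [envies_withBid_of_ne hj]

/-- Configurations reachable when agent `i` reports `f` and freely chooses the goods she
picks. -/
inductive Reach (b : Fin 3 → SetBid m) (i : Fin 3) (f : Finset (Fin m) →o ℝ) :
    Config m → Prop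
  | init : Reach b i f (initial m)
  | elim {s : Config m} : Reach b i f s → ¬ (sources (withBid b i f 1) s.1).Nonempty →
      Reach b i f (elimOnce (withBid b i f 1) s.1, s.2)
  | other {s : Config m} {q : Fin 3} (hR : s.2.Nonempty) : Reach b i f s →
      priAgent (withBid b i f 1) s.1 = some q → q ≠ i →
      Reach b i f (give s.1 q (preferredItem (b q).pref s.2 hR),
        s.2.erase (preferredItem (b q).pref s.2 hR))
  | pick {s : Config m} {g : Fin m} : Reach b i f s →
      priAgent (withBid b i f 1) s.1 = some i → g ∈ s.2 →
      Reach b i f (give s.1 i g, s.2.erase g)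

/-- The bundles and the set of unallocated goods partition the goods. -/
structure IsPartition (s : Config m) : Prop where
  disj_rest : ∀ j, Disjoint (s.1 j) s.2
  disj : ∀ j k, j ≠ k → Disjoint (s.1 j) (s.1 k)
  cover : ∀ x, x ∈ s.2 ∨ ∃ j, x ∈ s.1 j

theorem isPartition_initial : IsPartition (initial m) :=
  ⟨by simp [initial], by simp [initial], by simp [initial]⟩

theorem IsPartition.give {s : Config m} (h : IsPartition s) (q : Fin 3) {g : Fin m}
    (hg : g ∈ s.2) : IsPartition (give s.1 q g, s.2.erase g) := by
  have h0 : ∀ j, g ∉ s.1 j := fun j hj => disjoint_left.1 (h.disj_rest j) hj hg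
  refine ⟨fun j => ?_, fun j k hjk => ?_, fun x => ?_⟩
  · have := h.disj_rest j
    rw [disjoint_left] at this ⊢
    intro x hx
    by_cases hj : j = q
    · simp only [SubECE.give, hj, if_true, mem_insert] at hx
      subst hj
      rcases hx with rfl | hx
      · simp
      · simp [this hx]
    · simp only [SubECE.give, hj, if_false] at hx
      simp [this hx]
  · have := h.disj j k hjk
    simp only [SubECE.give]
    split_ifs with h1 h2
    · exact absurd (h1.trans h2.symm) hjk
    · simp [this, h0]
    · simp [this, h0]
    · exact this
  · by_cases hxg : x = g
    · exact Or.inr ⟨q, by simp [SubECE.give, hxg]⟩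
    · rcases h.cover x with hx | ⟨j, hj⟩
      · exact Or.inl (by simp [hxg, hx])
      · refine Or.inr ⟨j, ?_⟩
        simp only [SubECE.give]
        split_ifs <;> simp [hj]

theorem IsPartition.perm {s : Config m} (h : IsPartition s) (σ : Equiv.Perm (Fin 3)) :
    IsPartition (fun j => s.1 (σ j), s.2) := by
  refine ⟨fun j => h.disj_rest _, fun j k hjk => h.disj _ _ (by simpa using hjk), fun x => ?_⟩
  rcases h.cover x with hx | ⟨j, hj⟩
  · exact Or.inl hx
  · exact Or.inr ⟨σ.symm j, by simpa using hj⟩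

theorem Reach.isPartition {s : Config m} (h : Reach b i f s) : IsPartition s := by
  induction h with
  | init => exact isPartition_initial
  | elim _ hs ih =>
    obtain ⟨σ, -, -, he⟩ := exists_elimOnce_of_no_source hs
    rw [he]
    exact ih.perm σ
  | other hR _ _ _ ih => exact ih.give _ (preferredItem_mem _ _ _)
  | pick _ _ hg ih => exact ih.give _ hg

/-- Reachability depends only on the comparisons between sets of allocated goods. -/
theorem Reach.congr {s : Config m} (h : Reach b i f s)
    (hf : ∀ S T, Disjoint S s.2 → Disjoint T s.2 → (f S < f T ↔ f' S < f' T)) :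
    Reach b i f' s := by
  have hen : ∀ s : Config m, IsPartition s →
      (∀ S T, Disjoint S s.2 → Disjoint T s.2 → (f S < f T ↔ f' S < f' T)) →
      envies (withBid b i f 1) s.1 = envies (withBid b i f' 1) s.1 := fun s hp hs =>
    envies_withBid_congr fun k => hs _ _ (hp.disj_rest _) (hp.disj_rest _)
  induction h with
  | init => exact .init
  | elim h hs ih =>
    have he := hen _ h.isPartition hf
    rw [elimOnce_congr he]
    exact .elim (ih hf) (by rwa [← sources_congr he])
  | other hR h hq hqi ih =>
    have hf' := fun S T hS hT => hf S T (disjoint_of_subset_right (erase_subset _ _) hS)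
      (disjoint_of_subset_right (erase_subset _ _) hT)
    have he := hen _ h.isPartition hf'
    exact .other hR (ih hf') (by rwa [← priAgent_congr he]) hqi
  | pick h hq hg ih =>
    have hf' := fun S T hS hT => hf S T (disjoint_of_subset_right (erase_subset _ _) hS)
      (disjoint_of_subset_right (erase_subset _ _) hT)
    have he := hen _ h.isPartition hf'
    exact .pick (ih hf') (by rwa [← priAgent_congr he]) hg

theorem Reach.congr_eq {s : Config m} (h : Reach b i f s)
    (hf : ∀ S, Disjoint S s.2 → f' S = f S) : Reach b i f' s :=
  h.congr fun S T hS hT => by rw [hf S hS, hf T hT]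

/-- The goods of `L` come first, in this order, in the preference list `p`. -/
def IsInitial (p : Equiv.Perm (Fin m)) (L : List (Fin m)) : Prop :=
  ∀ l₁ x l₂, L = l₁ ++ x :: l₂ → ∀ y ∉ l₁, p x ≤ p y

theorem exists_isInitial (L : List (Fin m)) (hL : L.Nodup) :
    ∃ p : Equiv.Perm (Fin m), IsInitial p L := by
  set L' := L ++ (univ \ L.toFinset).toList with hL'
  have hnd : L'.Nodup := by
    rw [hL', List.nodup_append]
    refine ⟨hL, nodup_toList _, ?_⟩
    intro x hx y hy
    simp only [mem_toList, mem_sdiff, List.mem_toFinset] at hy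
    rintro rfl
    exact hy.2 hx
  have hmem : ∀ x, x ∈ L' := by
    intro x
    by_cases hx : x ∈ L
    · simp [hL', hx]
    · simp [hL', hx]
  have hlen : L'.length = m := by
    have := Fintype.card_congr (hnd.getEquivOfForallMemList _ hmem)
    simpa using this
  refine ⟨(hnd.getEquivOfForallMemList _ hmem).symm.trans (finCongr hlen), ?_⟩
  intro l₁ x l₂ h y hy
  have hx : x ∉ l₁ := by
    rw [h, List.nodup_append] at hL
    intro hx
    exact hL.2.2 x hx x (by simp) rfl
  have hL2 : L' = l₁ ++ (x :: (l₂ ++ (univ \ L.toFinset).toList)) := by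
    rw [hL', h]
    simp
  rw [Fin.le_def]
  change L'.idxOf x ≤ L'.idxOf y
  rw [hL2, List.idxOf_append_of_notMem hx, List.idxOf_append_of_notMem hy]
  simp

theorem Reach.exists_list {s : Config m} (h : Reach b i f s) :
    ∃ L : List (Fin m), L.Nodup ∧ (∀ x ∈ L, x ∉ s.2) ∧ (∀ x ∉ s.2, x ∈ L) ∧
      ∀ p, IsInitial p L → ∃ k, (step (withBid b i f p))^[k] (initial m) = s := by
  have hen : ∀ p P, envies (withBid b i f 1) P = envies (withBid b i f p) P := fun p P =>
    envies_withBid_congr fun _ => Iff.rfl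
  have hpre : ∀ {p : Equiv.Perm (Fin m)} {L : List (Fin m)} {g : Fin m},
      IsInitial p (L ++ [g]) → IsInitial p L := by
    intro p L g hp l₁ x l₂ hl
    refine hp l₁ x (l₂ ++ [g]) ?_
    rw [hl]
    simp
  induction h with
  | init => exact ⟨[], by simp, by simp, by simp [initial], fun p _ => ⟨0, rfl⟩⟩
  | elim h hs ih =>
    obtain ⟨L, h1, h2, h3, h4⟩ := ih
    refine ⟨L, h1, h2, h3, fun p hp => ?_⟩
    obtain ⟨k, hk⟩ := h4 p hp
    refine ⟨k + 1, ?_⟩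
    rw [Function.iterate_succ_apply', hk,
      step_elim (by rwa [← sources_congr (hen p _)]), elimOnce_congr (hen p _)]
  | @other s q hR h hq hqi ih =>
    obtain ⟨L, h1, h2, h3, h4⟩ := ih
    have hg := preferredItem_mem (b q).pref s.2 hR
    refine ⟨L ++ [preferredItem (b q).pref s.2 hR], ?_, ?_, ?_, fun p hp => ?_⟩
    · rw [List.nodup_append]
      refine ⟨h1, by simp, fun x hx y hy => ?_⟩
      simp only [List.mem_singleton] at hy
      rintro rfl
      exact h2 x hx (hy ▸ hg)
    · intro x hx
      rcases List.mem_append.1 hx with hx | hx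
      · simp [h2 x hx]
      · simp only [List.mem_singleton] at hx
        simp [hx]
    · intro x hx
      by_cases hxg : x = preferredItem (b q).pref s.2 hR
      · simp [← hxg]
      · simp [h3 x (fun hx2 => hx (mem_erase.2 ⟨hxg, hx2⟩))]
    · obtain ⟨k, hk⟩ := h4 p (hpre hp)
      refine ⟨k + 1, ?_⟩
      rw [Function.iterate_succ_apply', hk,
        step_add (q := q) (by rwa [← priAgent_congr (hen p _)]) hR]
      simp [withBid, hqi]
  | @pick s g h hq hg ih =>
    obtain ⟨L, h1, h2, h3, h4⟩ := ih
    refine ⟨L ++ [g], ?_, ?_, ?_, fun p hp => ?_⟩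
    · rw [List.nodup_append]
      refine ⟨h1, by simp, fun x hx y hy => ?_⟩
      simp only [List.mem_singleton] at hy
      rintro rfl
      exact h2 x hx (hy ▸ hg)
    · intro x hx
      rcases List.mem_append.1 hx with hx | hx
      · simp [h2 x hx]
      · simp only [List.mem_singleton] at hx
        simp [hx]
    · intro x hx
      by_cases hxg : x = g
      · simp [← hxg]
      · simp [h3 x (fun hx2 => hx (mem_erase.2 ⟨hxg, hx2⟩))]
    · obtain ⟨k, hk⟩ := h4 p (hpre hp)
      refine ⟨k + 1, ?_⟩
      have hp2 : preferredItem ((withBid b i f p) i).pref s.2 ⟨g, hg⟩ = g := by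
        refine preferredItem_eq _ hg fun y hy => ?_
        simp only [withBid, Function.update_self, mkBid]
        exact hp L g [] (by simp) y (fun hyL => h2 y hyL hy)
      rw [Function.iterate_succ_apply', hk,
        step_add (q := i) (by rwa [← priAgent_congr (hen p _)]) ⟨g, hg⟩, hp2]

theorem Reach.exists_run {s : Config m} (h : Reach b i f s) :
    ∃ p k, (step (withBid b i f p))^[k] (initial m) = s := by
  obtain ⟨L, h1, -, -, h4⟩ := h.exists_list
  obtain ⟨p, hp⟩ := exists_isInitial L h1
  exact ⟨p, h4 p hp⟩

/-- Every reachable configuration is followed by the outcome of some truthful run. -/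
theorem Reach.exists_outcome {s : Config m} (h : Reach b i f s) :
    ∃ p k, (step (withBid b i f p))^[k] s = (PreferredItemECE (withBid b i f p), ∅) := by
  obtain ⟨p, k, hk⟩ := h.exists_run
  obtain ⟨⟨N, hN⟩, hs⟩ := exists_iterate_step_eq_outcome (withBid b i f p)
  refine ⟨p, N, ?_⟩
  have hfix : ∀ t, (step (withBid b i f p))^[t] (PreferredItemECE (withBid b i f p), ∅) =
      (PreferredItemECE (withBid b i f p), ∅) := fun t =>
    Function.iterate_fixed
      (step_final (s := (PreferredItemECE (withBid b i f p), ∅)) hs rfl) t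
  rw [← hk, ← Function.iterate_add_apply, Nat.add_comm, Function.iterate_add_apply, hN, hfix]

/-- No bid of agent `i` gives her a bundle of value more than `V`. -/
structure Bounded (b : Fin 3 → SetBid m) (i : Fin 3) (v : Finset (Fin m) → ℝ) (V : ℝ) :
    Prop where
  mono : Monotone v
  le : ∀ c, v (PreferredItemECE (Function.update b i c) i) ≤ V

variable {v : Finset (Fin m) → ℝ} {V : ℝ}

theorem Bounded.le_of_subset (hV : Bounded b i v V) {s : Config m} (h : Reach b i f s)
    {Y : Finset (Fin m)} (hY : Y ⊆ s.1 i) (htop : ∀ S, ¬ Y ⊆ S → f S ≤ f Y) : v Y ≤ V := by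
  obtain ⟨p, k, hk⟩ := h.exists_outcome
  have key : ∀ t, Y ⊆ ((step (withBid b i f p))^[t] s).1 i := by
    intro t
    induction t with
    | zero => exact hY
    | succ t ih =>
      rw [Function.iterate_succ_apply']
      set s' := (step (withBid b i f p))^[t] s
      by_cases hs : (sources (withBid b i f p) s'.1).Nonempty
      · by_cases hR : s'.2.Nonempty
        · obtain ⟨q, hq⟩ := exists_priAgent hs
          rw [step_add hq hR]
          simp only [give]
          split_ifs
          · exact ih.trans (subset_insert _ _)
          · exact ih
        · rwa [step_final hs (not_nonempty_iff_eq_empty.1 hR)]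
      · rw [step_elim hs]
        obtain ⟨σ, -, hσ, he⟩ := exists_elimOnce_of_no_source hs
        rw [he]
        by_cases hi : σ i = i
        · simpa [hi] using ih
        · have h1 := envies_withBid_self.1 (hσ i hi)
          by_contra hcon
          exact absurd (htop _ hcon) (not_le.2 (lt_of_le_of_lt (f.mono ih) h1))
  have := key k
  rw [hk] at this
  exact (hV.mono this).trans (hV.le _)

theorem Bounded.le_of_final (hV : Bounded b i v V) {P : Fin 3 → Finset (Fin m)}
    (h : Reach b i f (P, ∅)) (hs : (sources (withBid b i f 1) P).Nonempty) :
    v (P i) ≤ V := by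
  obtain ⟨p, k, hk⟩ := h.exists_outcome
  have hs' : (sources (withBid b i f p) P).Nonempty := by
    rwa [sources_congr (envies_withBid_congr (f' := f) (p' := 1) fun _ => Iff.rfl)]
  rw [Function.iterate_fixed (step_final hs' rfl)] at hk
  have : P = _ := congrArg Prod.fst hk
  rw [this]
  exact hV.le _

/-- The report `f`, with the supersets of `K` raised to value at least `M`. -/
noncomputable def raise (f : Finset (Fin m) →o ℝ) (K : Finset (Fin m)) (M : ℝ) :
    Finset (Fin m) →o ℝ where
  toFun S := if K ⊆ S then max (f S) M else f S
  monotone' S T hST := by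
    have := f.mono hST
    dsimp only
    split_ifs with h1 h2
    · exact max_le_max this le_rfl
    · exact absurd (h1.trans hST) h2
    · exact this.trans (le_max_left _ _)
    · exact this

/-- The report `f`, ignoring the goods of `R`. -/
def forget (f : Finset (Fin m) →o ℝ) (R : Finset (Fin m)) : Finset (Fin m) →o ℝ where
  toFun S := f (S \ R)
  monotone' _ _ hST := f.mono (sdiff_subset_sdiff hST le_rfl)

theorem raise_of_subset {K S : Finset (Fin m)} {M : ℝ} (h : K ⊆ S) :
    raise f K M S = max (f S) M := if_pos h

theorem raise_of_not_subset {K S : Finset (Fin m)} {M : ℝ} (h : ¬ K ⊆ S) :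
    raise f K M S = f S := if_neg h

theorem forget_apply (R S : Finset (Fin m)) : forget f R S = f (S \ R) := rfl

theorem forget_of_disjoint {R S : Finset (Fin m)} (h : Disjoint S R) :
    forget f R S = f S := by
  rw [forget_apply, sdiff_eq_self_of_disjoint h]

theorem Reach.forget {s : Config m} (h : Reach b i f s) :
    Reach b i (forget f s.2) s :=
  h.congr_eq fun _ hS => forget_of_disjoint hS

theorem Reach.raise {s : Config m} (h : Reach b i f s) {K : Finset (Fin m)} {x : Fin m}
    (hxK : x ∈ K) (hx : x ∈ s.2) (M : ℝ) : Reach b i (raise f K M) s :=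
  h.congr_eq fun _ hS =>
    raise_of_not_subset fun hK => disjoint_left.1 hS (hK hxK) hx

/-- If agent `i` is to pick, all the bundles she can obtain by picking are bounded. -/
theorem Bounded.le_of_pick (hV : Bounded b i v V) {s : Config m} (h : Reach b i f s)
    (hi : priAgent (withBid b i f 1) s.1 = some i) :
    v (s.1 i) ≤ V ∧ ∀ x ∈ s.2, v (insert x (s.1 i)) ≤ V := by
  have h2 : ∀ x ∈ s.2, v (insert x (s.1 i)) ≤ V := by
    intro x hx
    set K := insert x (s.1 i) with hK
    have hxK : x ∈ K := mem_insert_self _ _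
    have hr := h.raise hxK hx (f univ)
    have hen : envies (withBid b i f 1) s.1 =
        envies (withBid b i (SubECE.raise f K (f univ)) 1) s.1 := by
      refine envies_withBid_congr fun k => ?_
      have h3 : ∀ k, ¬ K ⊆ s.1 k := fun k hk =>
        disjoint_left.1 (h.isPartition.disj_rest k) (hk hxK) hx
      rw [raise_of_not_subset (h3 _), raise_of_not_subset (h3 _)]
    rw [priAgent_congr hen] at hi
    refine hV.le_of_subset (Reach.pick hr hi hx) (Y := K) (by simp [give, hK]) fun S hS => ?_
    rw [raise_of_not_subset hS, raise_of_subset (subset_refl K)]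
    exact (f.mono (subset_univ S)).trans (le_max_right _ _)
  refine ⟨?_, h2⟩
  by_cases hR : s.2.Nonempty
  · obtain ⟨x, hx⟩ := hR
    exact (hV.mono (subset_insert x _)).trans (h2 x hx)
  · obtain ⟨P, R⟩ := s
    obtain rfl : R = ∅ := not_nonempty_iff_eq_empty.1 hR
    exact hV.le_of_final h ⟨i, priAgent_mem hi⟩

end Reachability

section Endgame

/-- The allocation giving `Z` to `i`, `Q` to `h` and `F` to the third agent. -/
def tri (i h : Fin 3) (Z Q F : Finset (Fin m)) : Fin 3 → Finset (Fin m) :=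
  fun j => if j = i then Z else if j = h then Q else F

/-- The agents `i`, `h`, `o` are distinct. -/
structure Roles (i h o : Fin 3) : Prop where
  hi : h ≠ i
  oi : o ≠ i
  oh : o ≠ h

variable {b : Fin 3 → SetBid m} {i h o : Fin 3} {f : Finset (Fin m) →o ℝ}
  {Z Q F R : Finset (Fin m)} {v : Finset (Fin m) → ℝ} {V : ℝ}
  {Lo : Finset (Fin m) → Prop}

theorem Roles.swap (r : Roles i h o) : Roles i o h := ⟨r.oi, r.hi, r.oh.symm⟩

theorem Roles.eq_or (r : Roles i h o) (j : Fin 3) : j = i ∨ j = h ∨ j = o := by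
  have key : ∀ i h o j : Fin 3, h ≠ i → o ≠ i → o ≠ h → j = i ∨ j = h ∨ j = o := by decide
  exact key i h o j r.hi r.oi r.oh

theorem tri_fst : tri i h Z Q F i = Z := by simp [tri]

theorem Roles.tri_snd (r : Roles i h o) : tri i h Z Q F h = Q := by simp [tri, r.hi]

theorem Roles.tri_trd (r : Roles i h o) : tri i h Z Q F o = F := by simp [tri, r.oi, r.oh]

theorem Roles.ext (r : Roles i h o) {P P' : Fin 3 → Finset (Fin m)} (h1 : P i = P' i)
    (h2 : P h = P' h) (h3 : P o = P' o) : P = P' := by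
  funext j
  rcases r.eq_or j with rfl | rfl | rfl <;> assumption

theorem Roles.perm_cases (r : Roles i h o) (σ : Equiv.Perm (Fin 3)) (hσ : σ ≠ 1) :
    (σ i = i ∧ σ h = o ∧ σ o = h) ∨ (σ i = h ∧ σ h = i ∧ σ o = o) ∨
      (σ i = h ∧ σ h = o ∧ σ o = i) ∨ σ i = o := by
  have hi := r.eq_or (σ i)
  have hh := r.eq_or (σ h)
  have ho := r.eq_or (σ o)
  have h1 : σ i ≠ σ h := fun e => r.hi (σ.injective e).symm
  have h2 : σ i ≠ σ o := fun e => r.oi (σ.injective e).symm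
  have h3 : σ h ≠ σ o := fun e => r.oh (σ.injective e).symm
  have h4 : ¬ (σ i = i ∧ σ h = h ∧ σ o = o) := fun ⟨e1, e2, e3⟩ =>
    hσ (Equiv.ext fun j => by rcases r.eq_or j with rfl | rfl | rfl <;> assumption)
  have r1 := r.hi
  have r2 := r.oi
  have r3 := r.oh
  grind

/-- `F` is the most desired bundle for the report `f`, strictly above every bundle not
containing it. -/
def Top (f : Finset (Fin m) →o ℝ) (F : Finset (Fin m)) : Prop := ∀ S, ¬ F ⊆ S → f S < f F

theorem Top.exists_between {f : Finset (Fin m) →o ℝ} (ht : Top f F) :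
    ∃ M < f F, ∀ S, ¬ F ⊆ S → f S < M := by
  by_cases hne : (univ.filter fun S => ¬ F ⊆ S).Nonempty
  · have h1 := exists_mem_eq_sup' hne f
    obtain ⟨S0, hS0, h2⟩ := h1
    obtain ⟨M, h3, h4⟩ := _root_.exists_between (ht S0 (mem_filter.1 hS0).2)
    refine ⟨M, h4, fun S hS => lt_of_le_of_lt ?_ h3⟩
    rw [← h2]
    exact le_sup' f (mem_filter.2 ⟨mem_univ _, hS⟩)
  · refine ⟨f F - 1, by linarith, fun S hS => ?_⟩
    exact absurd ⟨S, mem_filter.2 ⟨mem_univ _, hS⟩⟩ hne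

theorem Top.raise (ht : Top f F) {K : Finset (Fin m)} {M : ℝ} (hM : M < f F) :
    Top (raise f K M) F := by
  intro S hS
  have h1 : f F ≤ SubECE.raise f K M F := by
    by_cases hK : K ⊆ F
    · rw [raise_of_subset hK]
      exact le_max_left _ _
    · rw [raise_of_not_subset hK]
  refine lt_of_lt_of_le ?_ h1
  by_cases hK : K ⊆ S
  · rw [raise_of_subset hK]
    exact max_lt (ht S hS) hM
  · rw [raise_of_not_subset hK]
    exact ht S hS

/-- The configuration with bundles `Z` for `i`, `Q` for `h`, `F` for the third agent and
remaining goods `R` is reachable under a report `f` for which `F` is on top. -/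
structure Live (b : Fin 3 → SetBid m) (i : Fin 3) (F : Finset (Fin m))
    (f : Finset (Fin m) →o ℝ) (h : Fin 3) (Z Q R : Finset (Fin m)) : Prop where
  top : Top f F
  reach : Reach b i f (tri i h Z Q F, R)

/-- The bundle `F` is nonempty and worth more than agent `i` can get; bundles of value at
most `V` satisfy `Lo`. -/
structure Target (b : Fin 3 → SetBid m) (i : Fin 3) (v : Finset (Fin m) → ℝ) (V : ℝ)
    (Lo : Finset (Fin m) → Prop) (F : Finset (Fin m)) : Prop where
  bounded : Bounded b i v V
  ne : F.Nonempty
  win : ¬ v F ≤ V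
  lo : ∀ S, v S ≤ V → Lo S

/-- Adding any good of `R` to `Q` leaves a bundle satisfying `Lo`. -/
def Lx (Lo : Finset (Fin m) → Prop) (Q R : Finset (Fin m)) : Prop :=
  Lo Q ∧ ∀ x ∈ R, Lo (insert x Q)

theorem Lx.erase {Q R : Finset (Fin m)} (hx : Lx Lo Q R) (g : Fin m) : Lx Lo Q (R.erase g) :=
  ⟨hx.1, fun x h => hx.2 x (erase_subset _ _ h)⟩

/-- The goods of `R` can be split into two parts which, added to `Z` and `Q`, leave
bundles satisfying `Lo`. -/
def Splits (Lo : Finset (Fin m) → Prop) (Z Q R : Finset (Fin m)) : Prop :=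
  ∃ R₁ R₂, R ⊆ R₁ ∪ R₂ ∧ Lo (Z ∪ R₁) ∧ Lo (Q ∪ R₂)

theorem Splits.symm (hs : Splits Lo Z Q R) : Splits Lo Q Z R := by
  obtain ⟨R₁, R₂, h1, h2, h3⟩ := hs
  exact ⟨R₂, R₁, by rwa [union_comm], h3, h2⟩

theorem splits_empty (hZ : Lo Z) (hQ : Lo Q) : Splits Lo Z Q ∅ :=
  ⟨∅, ∅, by simp, by simpa using hZ, by simpa using hQ⟩

theorem Splits.of_insert {g : Fin m} (hs : Splits Lo (insert g Z) Q (R.erase g)) :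
    Splits Lo Z Q R := by
  obtain ⟨R₁, R₂, h1, h2, h3⟩ := hs
  refine ⟨insert g R₁, R₂, fun x hx => ?_, by simpa using h2, h3⟩
  by_cases hxg : x = g
  · simp [hxg]
  · have := h1 (mem_erase.2 ⟨hxg, hx⟩)
    simp only [mem_union, mem_insert] at this ⊢
    tauto

section Basic

theorem Target.not_reach (T : Target b i v V Lo F) (ht : Top f F) {s : Config m} (hs : s.1 i = F) :
    ¬ Reach b i f s := fun hr =>
  T.win (T.bounded.le_of_subset hr hs.ge fun S hS => (ht S hS).le)

theorem Live.disj (L : Live b i F f h Z Q R) (r : Roles i h o) :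
    Disjoint Z R ∧ Disjoint Q R ∧ Disjoint F R ∧ Disjoint Z Q ∧ Disjoint Z F ∧
      Disjoint Q F := by
  have hp := L.reach.isPartition
  have h1 := hp.disj_rest i
  have h2 := hp.disj_rest h
  have h3 := hp.disj_rest o
  have h4 := hp.disj i h r.hi.symm
  have h5 := hp.disj i o r.oi.symm
  have h6 := hp.disj h o r.oh.symm
  simp only [tri_fst, r.tri_snd, r.tri_trd] at h1 h2 h3 h4 h5 h6
  exact ⟨h1, h2, h3, h4, h5, h6⟩

theorem Target.not_subset (T : Target b i v V Lo F)
    {S : Finset (Fin m)} (hd : Disjoint S F) : ¬ F ⊆ S := by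
  intro hs
  obtain ⟨x, hx⟩ := T.ne
  exact disjoint_left.1 hd (hs hx) hx

theorem Live.lt_fst (T : Target b i v V Lo F)
    (L : Live b i F f h Z Q R) (r : Roles i h o) : f Z < f F :=
  L.top _ (T.not_subset (L.disj r).2.2.2.2.1)

/-- The cycle eliminations possible when nobody is a source. -/
theorem Live.elim (T : Target b i v V Lo F) (L : Live b i F f h Z Q R) (r : Roles i h o)
    (hi : (b h).val Q < (b h).val Z ∨ (b o).val F < (b o).val Z)
    (hh : f Z < f Q ∨ (b o).val F < (b o).val Q) :
    ((b h).val Q < (b h).val F ∧ (b o).val F < (b o).val Q ∧ Live b i F f o Z Q R) ∨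
    (f Z < f Q ∧ (b h).val Q < (b h).val Z ∧ Live b i F f h Q Z R) ∨
    (f Z < f Q ∧ (b h).val Q < (b h).val F ∧ (b o).val F < (b o).val Z ∧
      Live b i F f o Q Z R) := by
  have hZF := L.lt_fst T r
  have ei : ∀ k, envies (withBid b i f 1) (tri i h Z Q F) i k ↔ f Z < f (tri i h Z Q F k) :=
    fun k => by rw [envies_withBid_self, tri_fst]
  have eh : ∀ k, envies (withBid b i f 1) (tri i h Z Q F) h k ↔
      (b h).val Q < (b h).val (tri i h Z Q F k) :=
    fun k => by rw [envies_withBid_of_ne r.hi, r.tri_snd]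
  have eo : ∀ k, envies (withBid b i f 1) (tri i h Z Q F) o k ↔
      (b o).val F < (b o).val (tri i h Z Q F k) :=
    fun k => by rw [envies_withBid_of_ne r.oi, r.tri_trd]
  have hns : ¬ (sources (withBid b i f 1) (tri i h Z Q F)).Nonempty := by
    rintro ⟨q, hq⟩
    rw [mem_sources] at hq
    rcases r.eq_or q with rfl | rfl | rfl
    · rcases hi with hi | hi
      · exact hq h ((eh _).2 (by rwa [tri_fst]))
      · exact hq o ((eo _).2 (by rwa [tri_fst]))
    · rcases hh with hh | hh
      · exact hq i ((ei _).2 (by rwa [r.tri_snd]))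
      · exact hq o ((eo _).2 (by rwa [r.tri_snd]))
    · exact hq i ((ei _).2 (by rwa [r.tri_trd]))
  have hre := Reach.elim L.reach hns
  obtain ⟨σ, hσ1, hσ, he⟩ := exists_elimOnce_of_no_source hns
  simp only [he] at hre
  rcases r.perm_cases σ hσ1 with ⟨h1, h2, h3⟩ | ⟨h1, h2, h3⟩ | ⟨h1, h2, h3⟩ | h1
  · refine Or.inl ⟨?_, ?_, L.top, ?_⟩
    · simpa [h2, eh, r.tri_trd] using hσ h (by rw [h2]; exact r.oh)
    · simpa [h3, eo, r.tri_snd] using hσ o (by rw [h3]; exact r.oh.symm)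
    · rwa [r.ext (P := fun j => tri i h Z Q F (σ j)) (P' := tri i o Z Q F)] at hre
      · simp [h1, tri_fst]
      · simp [h2, r.tri_trd, r.swap.tri_trd]
      · simp [h3, r.tri_snd, r.swap.tri_snd]
  · refine Or.inr (Or.inl ⟨?_, ?_, L.top, ?_⟩)
    · simpa [h1, ei, r.tri_snd] using hσ i (by rw [h1]; exact r.hi)
    · simpa [h2, eh, tri_fst] using hσ h (by rw [h2]; exact r.hi.symm)
    · rwa [r.ext (P := fun j => tri i h Z Q F (σ j)) (P' := tri i h Q Z F)] at hre
      · simp [h1, r.tri_snd, tri_fst]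
      · simp [h2, tri_fst, r.tri_snd]
      · simp [h3, r.tri_trd]
  · refine Or.inr (Or.inr ⟨?_, ?_, ?_, L.top, ?_⟩)
    · simpa [h1, ei, r.tri_snd] using hσ i (by rw [h1]; exact r.hi)
    · simpa [h2, eh, r.tri_trd] using hσ h (by rw [h2]; exact r.oh)
    · simpa [h3, eo, tri_fst] using hσ o (by rw [h3]; exact r.oi.symm)
    · rwa [r.ext (P := fun j => tri i h Z Q F (σ j)) (P' := tri i o Q Z F)] at hre
      · simp [h1, r.tri_snd, tri_fst]
      · simp [h2, r.tri_trd, r.swap.tri_trd]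
      · simp [h3, tri_fst, r.swap.tri_snd]
  · refine absurd hre (T.not_reach L.top ?_)
    simp [h1, r.tri_trd]

theorem Live.pri_fst (T : Target b i v V Lo F) (L : Live b i F f h Z Q R) (r : Roles i h o)
    (h1 : ¬ (b h).val Q < (b h).val Z) (h2 : ¬ (b o).val F < (b o).val Z)
    (hc : (b h).val Q < (b h).val F → i < h) :
    priAgent (withBid b i f 1) (tri i h Z Q F) = some i := by
  have hZF := L.lt_fst T r
  have hio : envies (withBid b i f 1) (tri i h Z Q F) i o := by
    rwa [envies_withBid_self, tri_fst, r.tri_trd]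
  refine priAgent_eq (mem_sources.2 fun j => ?_) fun s hs hsi => ⟨⟨o, hio⟩, ?_⟩
  · rcases r.eq_or j with rfl | rfl | rfl
    · exact lt_irrefl _
    · rwa [envies_withBid_of_ne r.hi, r.tri_snd, tri_fst]
    · rwa [envies_withBid_of_ne r.oi, r.tri_trd, tri_fst]
  · rw [mem_sources] at hs
    rcases r.eq_or s with rfl | rfl | rfl
    · exact absurd rfl hsi
    · by_cases hcF : (b s).val Q < (b s).val F
      · exact Or.inr (hc hcF)
      · refine Or.inl fun j => ?_
        rw [envies_withBid_of_ne r.hi, r.tri_snd]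
        rcases r.eq_or j with rfl | rfl | rfl
        · rwa [tri_fst]
        · rw [r.tri_snd]
          exact lt_irrefl _
        · rwa [r.tri_trd]
    · exact absurd hio (hs i)

theorem Live.lx_fst (T : Target b i v V Lo F) (L : Live b i F f h Z Q R) (r : Roles i h o)
    (h1 : ¬ (b h).val Q < (b h).val Z) (h2 : ¬ (b o).val F < (b o).val Z)
    (hc : (b h).val Q < (b h).val F → i < h) : Lx Lo Z R := by
  obtain ⟨h3, h4⟩ := T.bounded.le_of_pick L.reach (L.pri_fst T r h1 h2 hc)
  simp only [tri_fst] at h3 h4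
  exact ⟨T.lo _ h3, fun x hx => T.lo _ (h4 x hx)⟩

theorem Live.pick (T : Target b i v V Lo F) (L : Live b i F f h Z Q R) (r : Roles i h o)
    (h1 : ¬ (b h).val Q < (b h).val Z) (h2 : ¬ (b o).val F < (b o).val Z)
    (hc : (b h).val Q < (b h).val F → i < h) {g : Fin m} (hg : g ∈ R) :
    Live b i F f h (insert g Z) Q (R.erase g) := by
  refine ⟨L.top, ?_⟩
  have := Reach.pick L.reach (L.pri_fst T r h1 h2 hc) hg
  rwa [r.ext (P := give (tri i h Z Q F) i g) (P' := tri i h (insert g Z) Q F)] at this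
  · simp [give, tri_fst]
  · simp [give, r.tri_snd, r.hi]
  · simp [give, r.tri_trd, r.oi]

theorem Live.pri_snd (T : Target b i v V Lo F) (L : Live b i F f h Z Q R) (r : Roles i h o)
    (h1 : (b h).val Q < (b h).val Z ∨ (b o).val F < (b o).val Z) (h2 : f Q ≤ f Z)
    (h3 : ¬ (b o).val F < (b o).val Q) :
    priAgent (withBid b i f 1) (tri i h Z Q F) = some h := by
  have hZF := L.lt_fst T r
  refine priAgent_eq (mem_sources.2 fun j => ?_) fun s hs hsi => ?_
  · rcases r.eq_or j with rfl | rfl | rfl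
    · rw [envies_withBid_self, tri_fst, r.tri_snd]
      exact not_lt.2 h2
    · exact lt_irrefl _
    · rwa [envies_withBid_of_ne r.oi, r.tri_trd, r.tri_snd]
  · exfalso
    rw [mem_sources] at hs
    rcases r.eq_or s with rfl | rfl | rfl
    · rcases h1 with h1 | h1
      · exact hs h (by rwa [envies_withBid_of_ne r.hi, r.tri_snd, tri_fst])
      · exact hs o (by rwa [envies_withBid_of_ne r.oi, r.tri_trd, tri_fst])
    · exact hsi rfl
    · exact hs i (by rwa [envies_withBid_self, tri_fst, r.tri_trd])

theorem Live.give_snd (T : Target b i v V Lo F) (L : Live b i F f h Z Q R) (r : Roles i h o)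
    (h1 : (b h).val Q < (b h).val Z ∨ (b o).val F < (b o).val Z) (h2 : f Q ≤ f Z)
    (h3 : ¬ (b o).val F < (b o).val Q) (hR : R.Nonempty) :
    Live b i F f h Z (insert (preferredItem (b h).pref R hR) Q)
      (R.erase (preferredItem (b h).pref R hR)) := by
  refine ⟨L.top, ?_⟩
  have := Reach.other hR L.reach (L.pri_snd T r h1 h2 h3) r.hi
  rwa [r.ext (P := give (tri i h Z Q F) h _) (P' := tri i h Z (insert _ Q) F)] at this
  · simp [give, tri_fst, r.hi.symm]
  · simp [give, r.tri_snd]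
  · simp [give, r.tri_trd, r.oh]

theorem Live.lo_fst_of_final (T : Target b i v V Lo F) (L : Live b i F f h Z Q ∅)
    {q : Fin 3} (hq : priAgent (withBid b i f 1) (tri i h Z Q F) = some q) : Lo Z := by
  have := T.bounded.le_of_final L.reach ⟨q, priAgent_mem hq⟩
  rw [tri_fst] at this
  exact T.lo _ this

theorem Live.forget (L : Live b i F f h Z Q R) (r : Roles i h o) :
    Live b i F (forget f R) h Z Q R := by
  refine ⟨fun S hS => ?_, L.reach.forget⟩
  rw [forget_of_disjoint (L.disj r).2.2.1, forget_apply]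
  exact L.top _ fun h => hS (h.trans sdiff_subset)

/-- Agent `i`'s report may be modified so that the bundle `insert x S`, with `x`
unallocated, is above every bundle not containing `F`. -/
theorem Live.exists_raise (L : Live b i F f h Z Q R) {x : Fin m}
    (hx : x ∈ R) (S : Finset (Fin m)) :
    ∃ f', Live b i F f' h Z Q R ∧ (∀ Y, x ∉ Y → f' Y = f Y) ∧
      ∀ Y, ¬ F ⊆ Y → x ∉ Y → f' Y < f' (insert x S) := by
  obtain ⟨M, hM, hM2⟩ := L.top.exists_between
  have hxS : x ∈ insert x S := mem_insert_self _ _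
  have h1 : ∀ Y, x ∉ Y → raise f (insert x S) M Y = f Y := fun Y hY =>
    raise_of_not_subset fun hs => hY (hs hxS)
  refine ⟨raise f (insert x S) M, ⟨L.top.raise hM, L.reach.raise hxS hx M⟩, h1,
    fun Y hY hxY => ?_⟩
  rw [h1 Y hxY, raise_of_subset (subset_refl _)]
  exact lt_of_lt_of_le (hM2 Y hY) (le_max_right _ _)

end Basic

end Endgame

section MainInduction

variable {b : Fin 3 → SetBid m} {i h o : Fin 3} {f : Finset (Fin m) →o ℝ}
  {Z Q F R : Finset (Fin m)} {v : Finset (Fin m) → ℝ} {V : ℝ}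
  {Lo : Finset (Fin m) → Prop}

/-- Either adding goods of `R` to `Q` is harmless, or the configuration is also reachable
under a report preferring `Q` to `Z`. -/
def Alt (b : Fin 3 → SetBid m) (i : Fin 3) (Lo : Finset (Fin m) → Prop)
    (F : Finset (Fin m)) (h : Fin 3) (Z Q R : Finset (Fin m)) : Prop :=
  Lx Lo Q R ∨ ∃ f, Live b i F f h Z Q R ∧ f Z < f Q

/-- Splitting of the remaining goods when `i` is not envied. -/
def SplitsUnenvied (b : Fin 3 → SetBid m) (i : Fin 3) (Lo : Finset (Fin m) → Prop)
    (F R : Finset (Fin m)) : Prop :=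
  ∀ ⦃h o Z Q f⦄, Roles i h o → ((b h).val Q < (b h).val F → i < h) → Live b i F f h Z Q R →
    f Q ≤ f Z → ¬ (b h).val Q < (b h).val Z → ¬ (b o).val F < (b o).val Z → Lo Q →
    Alt b i Lo F h Z Q R → Splits Lo Z Q R

/-- Splitting of the remaining goods when `i` is envied. -/
def SplitsEnvied (b : Fin 3 → SetBid m) (i : Fin 3) (Lo : Finset (Fin m) → Prop)
    (F R : Finset (Fin m)) : Prop :=
  ∀ ⦃h o Z Q f⦄, Roles i h o → ((b h).val Q < (b h).val F → i < h) → Live b i F f h Z Q R →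
    f Q ≤ f Z → ((b h).val Q < (b h).val Z ∨ (b o).val F < (b o).val Z) →
    ¬ (b o).val F < (b o).val Q → Lx Lo Q R → Splits Lo Z Q R

/-- Splitting of the remaining goods right after a good was added. -/
def SplitsGeneral (b : Fin 3 → SetBid m) (i : Fin 3) (Lo : Finset (Fin m) → Prop)
    (F R : Finset (Fin m)) : Prop :=
  ∀ ⦃h o Z Q f⦄, Roles i h o → ((b h).val Q < (b h).val F → i < h) → Live b i F f h Z Q R →
    f Q ≤ f Z → Lo Q → Alt b i Lo F h Z Q R → Splits Lo Z Q R

theorem Target.splitsUnenvied (T : Target b i v V Lo F)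
    (hrec : ∀ g ∈ R, SplitsGeneral b i Lo F (R.erase g)) :
    SplitsUnenvied b i Lo F R := by
  intro h o Z Q f r hc L hcont h1 h2 hQ halt
  by_cases hR : R.Nonempty
  · obtain ⟨g, hg⟩ := hR
    have key : ∀ {f'}, Live b i F f' h Z Q R →
        Live b i F (forget f' R) h (insert g Z) Q (R.erase g) ∧
        forget f' R (insert g Z) = f' Z ∧ forget f' R Q = f' Q := by
      intro f' L'
      have hd := L'.disj r
      refine ⟨(L'.forget r).pick T r h1 h2 hc hg, ?_, forget_of_disjoint hd.2.1⟩
      rw [forget_apply, insert_sdiff_of_mem _ hg, sdiff_eq_self_of_disjoint hd.1]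
    obtain ⟨L', e1, e2⟩ := key L
    refine (hrec g hg r hc L' (by rwa [e1, e2]) hQ ?_).of_insert
    rcases halt with hl | ⟨f', L2, hf'⟩
    · exact Or.inl (hl.erase g)
    · obtain ⟨L2', e1, e2⟩ := key L2
      exact Or.inr ⟨_, L2', by rwa [e1, e2]⟩
  · obtain rfl := not_nonempty_iff_eq_empty.1 hR
    exact splits_empty (L.lo_fst_of_final T (L.pri_fst T r h1 h2 hc)) hQ

theorem Target.splitsEnvied (T : Target b i v V Lo F)
    (hrec : ∀ g ∈ R, SplitsGeneral b i Lo F (R.erase g)) :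
    SplitsEnvied b i Lo F R := by
  intro h o Z Q f r hc L hcont h1 h2 hl
  by_cases hR : R.Nonempty
  · set x := preferredItem (b h).pref R hR with hx
    have hxR : x ∈ R := preferredItem_mem _ _ _
    have hd := L.disj r
    have hxQ : x ∉ Q := fun hQ => disjoint_left.1 hd.2.1 hQ hxR
    have hxZ : x ∉ Z := fun hZ => disjoint_left.1 hd.1 hZ hxR
    have hc' : (b h).val (insert x Q) < (b h).val F → i < h := fun h3 =>
      hc (lt_of_le_of_lt (by rw [insert_eq, union_comm]; exact (b h).mono Q {x}) h3)
    have L0 := L.forget r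
    have e1 : forget f R Z = f Z := forget_of_disjoint hd.1
    have e2 : forget f R Q = f Q := forget_of_disjoint hd.2.1
    have e3 : forget f R (insert x Q) = f Q := by
      rw [forget_apply, insert_sdiff_of_mem _ hxR, sdiff_eq_self_of_disjoint hd.2.1]
    have L1 := L0.give_snd T r h1 (by rwa [e1, e2]) h2 hR
    obtain ⟨f2, L2, h4, h5⟩ := L0.exists_raise hxR Q
    have L3 := L2.give_snd T r h1 (by rwa [h4 _ hxQ, h4 _ hxZ, e1, e2]) h2 hR
    have := hrec x hxR r hc' L1 (by rwa [e1, e3]) (hl.2 x hxR)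
      (Or.inr ⟨f2, L3, h5 Z (T.not_subset hd.2.2.2.2.1) hxZ⟩)
    exact this.symm.of_insert.symm
  · obtain rfl := not_nonempty_iff_eq_empty.1 hR
    exact splits_empty (L.lo_fst_of_final T (L.pri_snd T r h1 hcont h2)) hl.1

theorem Target.splits_of_not_envies (T : Target b i v V Lo F) (hU : SplitsUnenvied b i Lo F R)
    (hV : SplitsEnvied b i Lo F R) (r : Roles i h o)
    (hc : (b h).val Q < (b h).val F → i < h) (L : Live b i F f h Z Q R) (hcont : f Q ≤ f Z)
    (hQ : Lo Q) (halt : Alt b i Lo F h Z Q R) (h2 : ¬ (b o).val F < (b o).val Q) :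
    Splits Lo Z Q R := by
  by_cases h1 : (b h).val Q < (b h).val Z ∨ (b o).val F < (b o).val Z
  · have fin : Lx Lo Q R → Splits Lo Z Q R := hV r hc L hcont h1 h2
    rcases halt with hl | ⟨f', L', hf'⟩
    · exact fin hl
    · rcases L'.elim T r h1 (Or.inl hf') with ⟨-, e2, -⟩ | ⟨-, e2, L2⟩ | ⟨-, e2, e3, L2⟩
      · exact absurd e2 h2
      · exact fin (L2.lx_fst T r e2.not_gt h2 fun e => hc (e2.trans e))
      · refine fin (L2.lx_fst T r.swap (fun e => h2 (e3.trans e)) e2.not_gt fun e => ?_)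
        exact absurd e e3.not_gt
  · push Not at h1
    exact hU r hc L hcont h1.1.not_gt h1.2.not_gt hQ halt

theorem Target.splitsGeneral (T : Target b i v V Lo F) (hU : SplitsUnenvied b i Lo F R)
    (hV : SplitsEnvied b i Lo F R) : SplitsGeneral b i Lo F R := by
  intro h o Z Q f r hc L hcont hQ halt
  by_cases oq : (b o).val F < (b o).val Q
  swap
  · exact T.splits_of_not_envies hU hV r hc L hcont hQ halt oq
  by_cases h1 : (b h).val Q < (b h).val Z ∨ (b o).val F < (b o).val Z
  swap
  · push Not at h1
    exact hU r hc L hcont h1.1.not_gt h1.2.not_gt hQ halt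
  obtain ⟨hF, LP⟩ : (b h).val Q < (b h).val F ∧ Live b i F f o Z Q R := by
    rcases L.elim T r h1 (Or.inr oq) with ⟨e1, -, e3⟩ | ⟨e1, -⟩ | ⟨e1, -⟩
    · exact ⟨e1, e3⟩
    · exact absurd e1 hcont.not_gt
    · exact absurd e1 hcont.not_gt
  have hih := hc hF
  have hcP : (b o).val Q < (b o).val F → i < o := fun e => absurd e oq.not_gt
  have finAlt : Alt b i Lo F o Z Q R → Splits Lo Z Q R := fun ha =>
    T.splits_of_not_envies hU hV r.swap hcP LP hcont hQ ha hF.not_gt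
  have fin : Lx Lo Q R → Splits Lo Z Q R := fun hl => finAlt (Or.inl hl)
  have hK : ∀ f', Live b i F f' o Q Z R → f' Z < f' Q → (b o).val F < (b o).val Z →
      Splits Lo Z Q R := by
    intro f' LK hf' oz
    have hcK : (b o).val Z < (b o).val F → i < o := fun e => absurd e oz.not_gt
    by_cases zq : (b o).val Z < (b o).val Q
    · by_cases hz : (b h).val F < (b h).val Z
      · exfalso
        rcases LK.elim T r.swap (Or.inl zq) (Or.inr hz) with ⟨e1, -⟩ | ⟨e1, -⟩ | ⟨e1, -⟩
        · exact oz.not_gt e1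
        · exact hf'.not_gt e1
        · exact hf'.not_gt e1
      · have hl := LP.lx_fst T r.swap zq.not_gt hz hcP
        exact (hV r.swap hcK LK hf'.le (Or.inl zq) hz hl).symm
    · exact fin (LK.lx_fst T r.swap zq hF.not_gt hcK)
  rcases halt with hl | ⟨f', L', hf'⟩
  · exact fin hl
  rcases L'.elim T r h1 (Or.inl hf') with ⟨-, -, L2⟩ | ⟨-, e2, L2⟩ | ⟨-, -, e3, L2⟩
  · exact finAlt (Or.inr ⟨f', L2, hf'⟩)
  · by_cases oz : (b o).val F < (b o).val Z
    · rcases L2.elim T r (Or.inr oq) (Or.inr oz) with ⟨-, -, L3⟩ | ⟨e1, -⟩ | ⟨e1, -⟩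
      · exact hK f' L3 hf' oz
      · exact absurd e1 hf'.not_gt
      · exact absurd e1 hf'.not_gt
    · have zq : (b o).val Z < (b o).val Q := lt_of_le_of_lt (not_lt.1 oz) oq
      by_cases hz : (b h).val F < (b h).val Z
      · by_cases hR : R.Nonempty
        · exfalso
          set x := preferredItem (b o).pref R hR with hx
          have hxR : x ∈ R := preferredItem_mem _ _ _
          have hd := L.disj r
          have hxQ : x ∉ Q := fun hQ => disjoint_left.1 hd.2.1 hQ hxR
          have hxZ : x ∉ Z := fun hZ => disjoint_left.1 hd.1 hZ hxR
          obtain ⟨f2, L3, h4, h5⟩ := LP.exists_raise hxR Q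
          have L4 := L3.give_snd T r.swap (Or.inr hz) (by rwa [h4 _ hxQ, h4 _ hxZ])
            hF.not_gt hR
          have hx5 := h5 Z (T.not_subset hd.2.2.2.2.1) hxZ
          have hle : (b o).val Q ≤ (b o).val (insert x Q) := by
            rw [insert_eq, union_comm]
            exact (b o).mono _ _
          rcases L4.elim T r.swap (Or.inr hz) (Or.inl hx5) with
            ⟨e1, -⟩ | ⟨-, e2, -⟩ | ⟨-, e2, -⟩
          · exact (oq.trans_le hle).not_gt e1
          · exact (zq.trans_le hle).not_gt e2
          · exact (oq.trans_le hle).not_gt e2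
        · obtain rfl := not_nonempty_iff_eq_empty.1 hR
          exact splits_empty
            (LP.lo_fst_of_final T (LP.pri_snd T r.swap (Or.inr hz) hcont hF.not_gt)) hQ
      · have hl := LP.lx_fst T r.swap zq.not_gt hz hcP
        exact (hV r (fun _ => hih) L2 hf'.le (Or.inr oq) oz hl).symm
  · exact hK f' L2 hf' e3

theorem Target.splitsGeneral_all (T : Target b i v V Lo F)
    (R : Finset (Fin m)) : SplitsGeneral b i Lo F R := by
  induction R using Finset.strongInduction with
  | H R ih =>
    have hrec : ∀ g ∈ R, SplitsGeneral b i Lo F (R.erase g) := fun g hg =>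
      ih _ (erase_ssubset hg)
    exact T.splitsGeneral (T.splitsUnenvied hrec) (T.splitsEnvied hrec)

theorem Live.splits_of_step (T : Target b i v V Lo F)
    (r : Roles i h o) (hc : (b h).val Q < (b h).val F → i < h)
    (L : Live b i F f h Z Q R) (hZ : Lx Lo Z R) (hQ : Lx Lo Q R)
    (hrec : (b h).val Q < (b h).val F → (b o).val F < (b o).val Q → Live b i F f o Z Q R →
      Splits Lo Z Q R) : Splits Lo Z Q R := by
  by_cases hcont : f Z < f Q
  swap
  · exact T.splitsGeneral_all R r hc L (not_lt.1 hcont) hQ.1 (Or.inl hQ)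
  by_cases h1 : (b h).val Q < (b h).val Z ∨ (b o).val F < (b o).val Z
  · rcases L.elim T r h1 (Or.inl hcont) with ⟨e1, e2, L2⟩ | ⟨-, e2, L2⟩ | ⟨-, -, e3, L2⟩
    · exact hrec e1 e2 L2
    · exact (T.splitsGeneral_all R r (fun e => hc (e2.trans e)) L2 hcont.le hZ.1
        (Or.inl hZ)).symm
    · exact (T.splitsGeneral_all R r.swap (fun e => absurd e e3.not_gt) L2 hcont.le hZ.1
        (Or.inl hZ)).symm
  · push Not at h1
    by_cases hR : R.Nonempty
    · obtain ⟨g, hg⟩ := hR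
      have hd := L.disj r
      have hgQ : g ∉ Q := fun hQ => disjoint_left.1 hd.2.1 hQ hg
      obtain ⟨f2, L2, h4, h5⟩ := L.exists_raise hg Z
      have L3 := L2.pick T r h1.1.not_gt h1.2.not_gt hc hg
      exact (T.splitsGeneral_all _ r hc L3 (h5 Q (T.not_subset hd.2.2.2.2.2) hgQ).le hQ.1
        (Or.inl (hQ.erase g))).of_insert
    · obtain rfl := not_nonempty_iff_eq_empty.1 hR
      exact splits_empty hZ.1 hQ.1

/-- The remaining goods split as soon as the holder of the other bundle does not precede
`i` while desiring `F`. -/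
theorem Live.splits (T : Target b i v V Lo F)
    (r : Roles i h o) (hc : (b h).val Q < (b h).val F → i < h)
    (L : Live b i F f h Z Q R) (hZ : Lx Lo Z R) (hQ : Lx Lo Q R) : Splits Lo Z Q R :=
  L.splits_of_step T r hc hZ hQ fun _ e2 L2 =>
    L2.splits_of_step T r.swap (fun e => absurd e e2.not_gt) hZ hQ fun e _ _ =>
      absurd e e2.not_gt

end MainInduction

section TruthfulRun

variable {b : Fin 3 → SetBid m} {i h o : Fin 3} {f : Finset (Fin m) →o ℝ}
  {F B : Finset (Fin m)} {v : Finset (Fin m) → ℝ} {V : ℝ} {N k : ℕ}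

/-- The small-step run of the profile `b`. -/
noncomputable def run (b : Fin 3 → SetBid m) (k : ℕ) : Config m := (step b)^[k] (initial m)

theorem run_succ : run b (k + 1) = step b (run b k) := Function.iterate_succ_apply' _ _ _

theorem SetBid.val_le (c : SetBid m) {S T : Finset (Fin m)} (hST : S ⊆ T) :
    c.val S ≤ c.val T := by
  have := c.mono S T
  rwa [union_eq_right.2 hST] at this

/-- The reported valuation of a bid as a monotone function. -/
def report (c : SetBid m) : Finset (Fin m) →o ℝ := ⟨c.val, fun _ _ => SetBid.val_le c⟩

theorem envies_withBid_report (P : Fin 3 → Finset (Fin m)) :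
    envies (withBid b i (report (b i)) 1) P = envies b P := by
  funext j k
  by_cases hj : j = i
  · subst hj
    rw [envies_withBid_self]
    rfl
  · rw [envies_withBid_of_ne hj]
    rfl

theorem Reach.step {s : Config m} (hr : Reach b i (report (b i)) s) :
    Reach b i (report (b i)) (step b s) := by
  have he := envies_withBid_report (b := b) (i := i) s.1
  by_cases hs : (sources b s.1).Nonempty
  · by_cases hR : s.2.Nonempty
    · obtain ⟨q, hq⟩ := exists_priAgent hs
      rw [step_add hq hR]
      rw [← priAgent_congr he] at hq
      by_cases hqi : q = i
      · subst hqi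
        exact hr.pick hq (preferredItem_mem _ _ _)
      · exact hr.other hR hq hqi
    · rwa [step_final hs (not_nonempty_iff_eq_empty.1 hR)]
  · rw [step_elim hs, ← elimOnce_congr he]
    exact hr.elim (by rwa [sources_congr he])

theorem reach_run (k : ℕ) : Reach b i (report (b i)) (run b k) := by
  induction k with
  | zero => exact .init
  | succ k ih =>
    rw [run_succ]
    exact ih.step

theorem step_snd_subset (s : Config m) : (step b s).2 ⊆ s.2 := by
  by_cases hs : (sources b s.1).Nonempty
  · by_cases hR : s.2.Nonempty
    · obtain ⟨q, hq⟩ := exists_priAgent hs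
      rw [step_add hq hR]
      exact erase_subset _ _
    · rw [step_final hs (not_nonempty_iff_eq_empty.1 hR)]
  · rw [step_elim hs]

theorem run_snd_subset {k l : ℕ} (hkl : k ≤ l) : (run b l).2 ⊆ (run b k).2 := by
  induction l, hkl using Nat.le_induction with
  | base => exact subset_refl _
  | succ l _ ih =>
    rw [run_succ]
    exact (step_snd_subset _).trans ih

/-- One bundle lies inside `B` and all the others are disjoint from `B`. -/
def Concentrated (B : Finset (Fin m)) (s : Config m) : Prop :=
  ∃ a, s.1 a ⊆ B ∧ ∀ c ≠ a, Disjoint (s.1 c) B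

theorem Concentrated.of_step {s : Config m} (hc : Concentrated B (step b s)) :
    Concentrated B s := by
  by_cases hs : (sources b s.1).Nonempty
  · by_cases hR : s.2.Nonempty
    · obtain ⟨q, hq⟩ := exists_priAgent hs
      rw [step_add hq hR] at hc
      have hsub : ∀ g j, s.1 j ⊆ give s.1 q g j := by
        intro g j
        simp only [give]
        split_ifs
        · exact subset_insert _ _
        · exact subset_refl _
      obtain ⟨a, h1, h2⟩ := hc
      exact ⟨a, (hsub _ a).trans h1, fun c hca => disjoint_of_subset_left (hsub _ c) (h2 c hca)⟩
    · rwa [step_final hs (not_nonempty_iff_eq_empty.1 hR)] at hc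
  · rw [step_elim hs] at hc
    obtain ⟨σ, -, -, he⟩ := exists_elimOnce_of_no_source hs
    rw [he] at hc
    obtain ⟨a, h1, h2⟩ := hc
    refine ⟨σ a, h1, fun c hca => ?_⟩
    have := h2 (σ.symm c) (fun e => hca (by rw [← e]; simp))
    simpa using this

theorem Concentrated.run_le (hc : Concentrated B (run b N)) (hk : k ≤ N) :
    Concentrated B (run b k) := by
  induction N, hk using Nat.le_induction with
  | base => exact hc
  | succ l _ ih =>
    rw [run_succ] at hc
    exact ih hc.of_step

theorem Concentrated.disjoint {s : Config m} (hc : Concentrated B s) (hF : F.Nonempty)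
    (hFB : F ⊆ B) (ho : s.1 o = F) {c : Fin 3} (hco : c ≠ o) : Disjoint (s.1 c) B := by
  obtain ⟨a, -, h2⟩ := hc
  by_cases hoa : o = a
  · exact h2 c (hoa ▸ hco)
  · have := h2 o hoa
    rw [ho] at this
    obtain ⟨x, hx⟩ := hF
    exact absurd (hFB hx) (disjoint_left.1 this hx)

/-- The first addition to produce a subset of `B` worth more than `V`. -/
theorem exists_first_addition (hB : ∃ a, (run b N).1 a ⊆ B ∧ V < v ((run b N).1 a))
    (h0 : v ∅ ≤ V) :
    ∃ k < N, ∃ q y, ∃ hR : (run b k).2.Nonempty, priAgent b (run b k).1 = some q ∧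
      y = preferredItem (b q).pref (run b k).2 hR ∧
      run b (k + 1) = (give (run b k).1 q y, (run b k).2.erase y) ∧
      insert y ((run b k).1 q) ⊆ B ∧ V < v (insert y ((run b k).1 q)) ∧
      v ((run b k).1 q) ≤ V := by
  have hex : ∃ N, ∃ a, (run b N).1 a ⊆ B ∧ V < v ((run b N).1 a) := ⟨N, hB⟩
  obtain ⟨a, ha, hva⟩ := Nat.find_spec hex
  have hmin : Nat.find hex ≤ N := Nat.find_min' hex hB
  have hlt := fun k (hk : k < Nat.find hex) => Nat.find_min hex hk
  obtain ⟨k, hk⟩ : ∃ k, Nat.find hex = k + 1 := by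
    refine Nat.exists_eq_succ_of_ne_zero fun h => ?_
    rw [h] at hva
    exact absurd h0 (not_le.2 hva)
  rw [hk] at ha hva hmin
  have hk' := hlt k (by omega)
  push Not at hk'
  have hstep : run b (k + 1) = step b (run b k) := run_succ
  refine ⟨k, by omega, ?_⟩
  by_cases hs : (sources b (run b k).1).Nonempty
  · by_cases hR : (run b k).2.Nonempty
    · obtain ⟨q, hq⟩ := exists_priAgent hs
      rw [step_add hq hR] at hstep
      refine ⟨q, _, hR, hq, rfl, hstep, ?_⟩
      rw [hstep] at ha hva
      by_cases haq : a = q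
      · subst haq
        simp only [give, if_true] at ha hva
        exact ⟨ha, hva, hk' a ((subset_insert _ _).trans ha)⟩
      · simp only [give, haq, if_false] at ha hva
        exact absurd (hk' a ha) (not_le.2 hva)
    · rw [step_final hs (not_nonempty_iff_eq_empty.1 hR)] at hstep
      rw [hstep] at ha hva
      exact absurd (hk' a ha) (not_le.2 hva)
  · rw [step_elim hs] at hstep
    obtain ⟨σ, -, -, he⟩ := exists_elimOnce_of_no_source hs
    rw [hstep, he] at ha hva
    exact absurd (hk' _ ha) (not_le.2 hva)

theorem priAgent_eq_of_not_envious {P : Fin 3 → Finset (Fin m)} {q : Fin 3}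
    (hq : q ∈ sources b P) (h1 : ∀ j k, ¬ envies b P j k) (h2 : ∀ s, q ≤ s) :
    priAgent b P = some q := by
  unfold priAgent
  rw [dif_neg, dif_pos ⟨q, hq⟩]
  · congr 1
    exact le_antisymm (min'_le _ _ hq) (h2 _)
  · rintro ⟨s, hs⟩
    obtain ⟨-, j, hj⟩ := mem_filter.1 hs
    exact h1 _ _ hj

theorem mem_sources_of_empty {P : Fin 3 → Finset (Fin m)} {q : Fin 3} (hq : P q = ∅) :
    q ∈ sources b P :=
  mem_sources.2 fun j => not_lt.2 (by rw [hq]; exact SetBid.val_le _ (empty_subset _))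

theorem priAgent_initial (b : Fin 3 → SetBid m) : priAgent b (initial m).1 = some 0 :=
  priAgent_eq_of_not_envious (mem_sources_of_empty rfl) (fun _ _ => lt_irrefl _)
    (fun _ => Fin.zero_le _)

/-- Cardinality as a report. -/
def cardReport (m : ℕ) : Finset (Fin m) →o ℝ :=
  ⟨fun S => (#S : ℝ), fun _ _ hST => Nat.cast_le.2 (card_le_card hST)⟩

theorem le_of_pick_single (hV : Bounded b i v V) {s : Config m} (hr : Reach b i f s)
    (hp : priAgent (withBid b i f 1) s.1 = some i) (hi : s.1 i = ∅) {x : Fin m}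
    (hx : x ∈ s.2) : v {x} ≤ V := by
  have := (hV.le_of_pick hr hp).2 x hx
  rwa [hi] at this

/-- A single good of `B` that is still unallocated once a bundle inside `B` exists is worth
at most `V`. -/
theorem Bounded.single_le (hV : Bounded b i v V) (hN : (run b N).2 = ∅)
    (hc : Concentrated B (run b N)) (hk : 1 ≤ k) (hkN : k ≤ N) {o : Fin 3}
    (hne : ((run b k).1 o).Nonempty) (hoB : (run b k).1 o ⊆ B) {x : Fin m} (hxB : x ∈ B)
    (hx : x ∈ (run b k).2) : v {x} ≤ V := by
  set f := cardReport m with hf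
  have hrun0 : run b 0 = initial m := rfl
  have hx1 : x ∈ (run b 1).2 := run_snd_subset hk hx
  have hR0 : (initial m).2.Nonempty := ⟨x, mem_univ _⟩
  by_cases hi0 : i = 0
  · subst hi0
    exact le_of_pick_single hV (f := f) Reach.init (priAgent_initial _) rfl (mem_univ x)
  set a := preferredItem (b 0).pref (initial m).2 hR0 with ha
  have hr1 : run b 1 = (give (initial m).1 0 a, (initial m).2.erase a) := by
    rw [run_succ, hrun0, step_add (priAgent_initial _) hR0]
  have hreach1 : Reach b i f (run b 1) := by
    rw [hr1]
    exact Reach.other hR0 Reach.init (priAgent_initial _) (Ne.symm hi0)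
  have p10 : (run b 1).1 0 = {a} := by rw [hr1]; simp [give, initial]
  have p11 : (run b 1).1 1 = ∅ := by rw [hr1]; simp [give, initial]
  have p12 : (run b 1).1 2 = ∅ := by rw [hr1]; simp [give, initial]
  have hfa : f ∅ < f {a} := by
    change ((#(∅ : Finset (Fin m)) : ℕ) : ℝ) < ((#({a} : Finset (Fin m)) : ℕ) : ℝ)
    simp
  by_cases hi1 : i = 1
  · subst hi1
    have he : envies (withBid b 1 f 1) (run b 1).1 1 0 := by
      rwa [envies_withBid_self, p10, p11]
    refine le_of_pick_single hV hreach1 (priAgent_eq (mem_sources_of_empty p11)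
      fun s hs hs1 => ⟨⟨0, he⟩, ?_⟩) p11 hx1
    rw [mem_sources] at hs
    have hs0 : s ≠ 0 := fun e => hs 1 (e ▸ he)
    right
    revert hs0 hs1
    clear * -
    revert s
    decide
  have hi2 : i = 2 := by
    revert hi0 hi1
    clear * -
    revert i
    decide
  subst hi2
  have he : envies (withBid b 2 f 1) (run b 1).1 2 0 := by
    rwa [envies_withBid_self, p10, p12]
  by_cases h10 : (b 1).val ∅ < (b 1).val {a}
  swap
  · refine le_of_pick_single hV hreach1 (priAgent_eq (mem_sources_of_empty p12)
      fun s hs hs1 => ⟨⟨0, he⟩, Or.inl fun j => ?_⟩) p12 hx1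
    rw [mem_sources] at hs
    have hs0 : s ≠ 0 := fun e => hs 2 (e ▸ he)
    obtain rfl : s = 1 := by
      revert hs0 hs1
      clear * -
      revert s
      decide
    rw [envies_withBid_of_ne (by decide), p11]
    fin_cases j
    · simpa [p10] using h10
    · simp [p11]
    · simp [p12]
  have hpri : ∀ b' : Fin 3 → SetBid m, (b' 1).val = (b 1).val →
      priAgent b' (run b 1).1 = some 1 := by
    intro b' hb'
    have he' : envies b' (run b 1).1 1 0 := by
      unfold envies
      rwa [p10, p11, hb']
    refine priAgent_eq (mem_sources_of_empty p11) fun s hs hs1 => ⟨⟨0, he'⟩, Or.inr ?_⟩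
    rw [mem_sources] at hs
    have hs0 : s ≠ 0 := fun e => hs 1 (e ▸ he')
    revert hs0 hs1
    clear * -
    revert s
    decide
  have hR1 : (run b 1).2.Nonempty := ⟨x, hx1⟩
  set c := preferredItem (b 1).pref (run b 1).2 hR1 with hc'
  have hr2 : run b 2 = (give (run b 1).1 1 c, (run b 1).2.erase c) := by
    rw [run_succ, step_add (hpri b rfl) hR1]
  have hreach2 : Reach b 2 f (run b 2) := by
    rw [hr2]
    refine Reach.other hR1 hreach1 (hpri _ ?_) (by decide)
    simp [withBid]
  have p20 : (run b 2).1 0 = {a} := by rw [hr2]; simp [give, p10]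
  have p21 : (run b 2).1 1 = {c} := by rw [hr2]; simp [give, p11]
  have p22 : (run b 2).1 2 = ∅ := by rw [hr2]; simp [give, p12]
  have hfc : f ∅ < f {c} := by
    change ((#(∅ : Finset (Fin m)) : ℕ) : ℝ) < ((#({c} : Finset (Fin m)) : ℕ) : ℝ)
    simp
  have hx2 : x ∈ (run b 2).2 := by
    by_cases hk2 : 2 ≤ k
    · exact run_snd_subset hk2 hx
    · obtain rfl : k = 1 := by omega
      rw [hr2]
      refine mem_erase.2 ⟨fun hxc => ?_, hx1⟩
      have hN2 : 2 ≤ N := by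
        by_contra hcon
        obtain rfl : N = 1 := by omega
        rw [hN] at hx1
        simp at hx1
      have haB : a ∈ B := by
        fin_cases o
        · exact hoB (by simp [p10])
        · simp [p11] at hne
        · simp [p12] at hne
      have := (hc.run_le hN2).disjoint (o := 0) (F := {a}) (by simp)
        (by simpa using haB) p20 (c := 1) (by decide)
      rw [p21, disjoint_singleton_left, ← hxc] at this
      exact this hxB
  refine le_of_pick_single hV hreach2 (priAgent_eq (mem_sources_of_empty p22)
    fun s hs hs1 => ?_) p22 hx2
  exfalso
  rw [mem_sources] at hs
  have h2 := hs 2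
  rw [envies_withBid_self, p22] at h2
  fin_cases s
  · exact h2 (by simpa [p20] using hfa)
  · exact h2 (by simpa [p21] using hfc)
  · exact hs1 rfl

end TruthfulRun

section Comparison

variable {b : Fin 3 → SetBid m} {i h o : Fin 3} {f : Finset (Fin m) →o ℝ}
  {F B R₀ : Finset (Fin m)} {v : Finset (Fin m) → ℝ} {V : ℝ} {N : ℕ}
  {Lo : Finset (Fin m) → Prop}

theorem Roles.exists_of_ne (hoi : o ≠ i) : ∃ h, Roles i h o := by
  have key : ∀ i o : Fin 3, o ≠ i → ∃ h, h ≠ i ∧ o ≠ h := by decide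
  obtain ⟨h, h1, h2⟩ := key i o hoi
  exact ⟨h, h1, hoi, h2⟩

/-- While the third agent holds `F` and the second one, preceding `i`, desires it, a step
of the run is also a step under the report `f`, and `i` does not get `F`. -/
theorem Reach.step_of_top (T : Target b i v V Lo F) (ht : Top f F)
    (hf : ∀ Y, ¬ F ⊆ Y → f Y = (b i).val Y) {s : Config m} (hr : Reach b i f s)
    (r : Roles i h o) (hsF : s.1 o = F) (hlt : h < i)
    (hhF : (b h).val (s.1 h) < (b h).val F) :
    Reach b i f (SubECE.step b s) ∧
      ∃ o', o' ≠ i ∧ (s.2 = ∅ ∨ (SubECE.step b s).1 o' = F) := by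
  have hp := hr.isPartition
  have hns : ∀ k, k ≠ o → ¬ F ⊆ s.1 k := fun k hk =>
    T.not_subset (hsF ▸ hp.disj k o hk)
  have e1 : ∀ k, k ≠ o → f (s.1 k) = (b i).val (s.1 k) := fun k hk => hf _ (hns k hk)
  have hE : ∀ j k, ¬ (j = i ∧ k = o) →
      (envies b s.1 j k ↔ envies (withBid b i f 1) s.1 j k) := by
    intro j k hjk
    by_cases hj : j = i
    · subst hj
      have hk : k ≠ o := fun hk => hjk ⟨rfl, hk⟩
      rw [envies_withBid_self, e1 _ r.oi.symm, e1 _ hk]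
      rfl
    · rw [envies_withBid_of_ne hj]
      rfl
  have hE2 : ∀ j k, envies b s.1 j k → envies (withBid b i f 1) s.1 j k := by
    intro j k hjk
    by_cases hjo : j = i ∧ k = o
    · obtain ⟨rfl, rfl⟩ := hjo
      rw [envies_withBid_self, hsF]
      exact ht _ (hns _ r.oi.symm)
    · exact (hE j k hjo).1 hjk
  have hho : envies b s.1 h o := by
    unfold envies
    rwa [hsF]
  have hso : o ∉ sources b s.1 := fun hs => mem_sources.1 hs h hho
  have hsrc : sources (withBid b i f 1) s.1 = sources b s.1 := by
    ext q
    by_cases hq : q = o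
    · subst hq
      refine iff_of_false (fun hs => mem_sources.1 hs h (hE2 _ _ hho)) hso
    · rw [mem_sources, mem_sources]
      exact forall_congr' fun j => not_congr (hE j q fun hj => hq hj.2).symm
  by_cases hs : (sources b s.1).Nonempty
  · by_cases hR : s.2.Nonempty
    · have hpri : ∃ q, q ≠ o ∧ priAgent b s.1 = some q ∧
          priAgent (withBid b i f 1) s.1 = some q := by
        by_cases hh : h ∈ sources b s.1
        · have hor : ∀ t, t ≠ h → t ∈ sources b s.1 → h < t := by
            intro t hth hts
            rcases r.eq_or t with rfl | rfl | rfl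
            · exact hlt
            · exact absurd rfl hth
            · exact absurd hts hso
          refine ⟨h, r.oh.symm, ?_, ?_⟩
          · exact priAgent_eq hh fun t hts hth => ⟨⟨o, hho⟩, Or.inr (hor t hth hts)⟩
          · rw [← hsrc] at hh hor
            exact priAgent_eq hh fun t hts hth =>
              ⟨⟨o, hE2 _ _ hho⟩, Or.inr (hor t hth hts)⟩
        · have hall : ∀ t ∈ sources b s.1, t = i := by
            intro t hts
            rcases r.eq_or t with rfl | rfl | rfl
            · rfl
            · exact absurd hts hh
            · exact absurd hts hso
          obtain ⟨q, hq⟩ := exists_priAgent hs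
          obtain ⟨q', hq'⟩ := exists_priAgent (hsrc.symm ▸ hs)
          have h1 := hall q (priAgent_mem hq)
          have h2 := hall q' (hsrc ▸ priAgent_mem hq')
          exact ⟨i, r.oi.symm, h1 ▸ hq, h2 ▸ hq'⟩
      obtain ⟨q, hqo, hq, hq'⟩ := hpri
      rw [step_add hq hR]
      refine ⟨?_, o, r.oi, Or.inr ?_⟩
      · by_cases hqi : q = i
        · subst hqi
          exact hr.pick hq' (preferredItem_mem _ _ _)
        · exact hr.other hR hq' hqi
      · simp [give, hqo.symm, hsF]
    · rw [step_final hs (not_nonempty_iff_eq_empty.1 hR)]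
      exact ⟨hr, o, r.oi, Or.inl (not_nonempty_iff_eq_empty.1 hR)⟩
  · have hs' : ¬ (sources (withBid b i f 1) s.1).Nonempty := by rwa [hsrc]
    obtain ⟨σ, hσ, hmin, he⟩ := exists_elimOnce (cycleSet_nonempty hs)
    obtain ⟨σ', hσ', hmin', he'⟩ := exists_elimOnce (cycleSet_nonempty hs')
    have hr' := hr.elim hs'
    have hσi : σ' i ≠ o := by
      intro hio
      refine absurd hr' (T.not_reach ht ?_)
      rw [he']
      simp [hio, hsF]
    have h1 : σ' ∈ cycleSet b s.1 := by
      simp only [cycleSet, mem_filter, mem_univ, true_and] at hσ' ⊢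
      refine ⟨hσ'.1, fun j hj => (hE _ _ ?_).2 (hσ'.2 j hj)⟩
      rintro ⟨rfl, h2⟩
      exact hσi h2
    have h2 : σ ∈ cycleSet (withBid b i f 1) s.1 := by
      simp only [cycleSet, mem_filter, mem_univ, true_and] at hσ ⊢
      exact ⟨hσ.1, fun j hj => hE2 _ _ (hσ.2 j hj)⟩
    have h3 : σ = σ' := (permIdx 3).injective (le_antisymm (hmin _ h1) (hmin' _ h2))
    subst h3
    rw [step_elim hs, he, ← he']
    refine ⟨hr', σ.symm o, fun hio => hσi ?_, Or.inr ?_⟩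
    · rw [← hio]
      simp
    · rw [he']
      simp [hsF]

/-- From the configuration in which `F` appears, the goods of `B` outside `F` split. -/
theorem exists_splits (T : Target b i v V Lo F) (ht : Top f F)
    (hf : ∀ Y, ¬ F ⊆ Y → f Y = (b i).val Y) (hFB : F ⊆ B)
    (hN : (run b N).2 = ∅) (hc : Concentrated B (run b N))
    (hlx : ∀ Z R, Disjoint Z B → R ⊆ R₀ → Lx Lo Z R) (t : ℕ) :
    ∀ k, k + t = N → (run b k).2 ⊆ R₀ → ∀ o ≠ i, (run b k).1 o = F →
      Reach b i f (run b k) →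
      ∃ Z Q R, Disjoint Z B ∧ Disjoint Q B ∧ B ⊆ F ∪ R ∧ Splits Lo Z Q R := by
  induction t with
  | zero =>
    intro k hk _ o hoi hoF hr
    obtain rfl : k = N := by omega
    refine ⟨∅, ∅, ∅, disjoint_empty_left _, disjoint_empty_left _, fun x hx => ?_,
      splits_empty (hlx ∅ ∅ (disjoint_empty_left _) (empty_subset _)).1
        (hlx ∅ ∅ (disjoint_empty_left _) (empty_subset _)).1⟩
    rcases hr.isPartition.cover x with h | ⟨j, hj⟩
    · rw [hN] at h
      simp at h
    · by_cases hjo : j = o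
      · subst hjo
        simp [← hoF, hj]
      · exact absurd hx (disjoint_left.1 (hc.disjoint T.ne hFB hoF hjo) hj)
  | succ t ih =>
    intro k hk hR₀ o hoi hoF hr
    have hck := hc.run_le (show k ≤ N by omega)
    have hdisj := fun c hco => hck.disjoint T.ne hFB hoF (c := c) hco
    obtain ⟨h, r⟩ := Roles.exists_of_ne hoi
    have hBF : B ⊆ F ∪ (run b k).2 := by
      intro x hx
      rcases hr.isPartition.cover x with h | ⟨j, hj⟩
      · exact mem_union_right _ h
      · by_cases hjo : j = o
        · subst hjo
          exact mem_union_left _ (hoF ▸ hj)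
        · exact absurd hx (disjoint_left.1 (hdisj j hjo) hj)
    by_cases hcond : (b h).val ((run b k).1 h) < (b h).val F ∧ h < i
    · obtain ⟨h1, o', ho', h2⟩ := hr.step_of_top T ht hf r hoF hcond.2 hcond.1
      rcases h2 with h2 | h2
      · have h0 := (hlx ∅ ∅ (disjoint_empty_left _) (empty_subset _)).1
        rw [h2] at hBF
        exact ⟨∅, ∅, ∅, disjoint_empty_left _, disjoint_empty_left _, hBF,
          splits_empty h0 h0⟩
      · rw [← run_succ] at h1 h2
        exact ih (k + 1) (by omega) ((run_snd_subset (Nat.le_succ k)).trans hR₀) o' ho' h2 h1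
    · refine ⟨(run b k).1 i, (run b k).1 h, (run b k).2, hdisj _ r.oi.symm, hdisj _ r.oh.symm,
        hBF, ?_⟩
      have L : Live b i F f h ((run b k).1 i) ((run b k).1 h) (run b k).2 := by
        refine ⟨ht, ?_⟩
        rwa [← r.ext (P := (run b k).1)
          (P' := tri i h ((run b k).1 i) ((run b k).1 h) F) tri_fst.symm r.tri_snd.symm
          (by rw [r.tri_trd, hoF])]
      refine L.splits T r (fun e => ?_) (hlx _ _ (hdisj _ r.oi.symm) hR₀)
        (hlx _ _ (hdisj _ r.oh.symm) hR₀)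
      exact lt_of_le_of_ne (not_lt.1 fun e2 => hcond ⟨e, e2⟩) r.hi.symm

end Comparison

end SubECE

/-- For any instance with exactly 3 agents whose true valuations are
nonnegative monotone subadditive set functions, and any bid profile in which agent
`i`'s bid is a best response to the other agents' bids, the allocation produced by
Preferred-Item-E-C-E is `(1/3)`-EF1 from agent `i`'s perspective with respect to agent
`i`'s true valuation. -/
theorem preferredItem_three_subadditive_best_response_third_EF1 {m : ℕ}
    (v : Fin 3 → Finset (Fin m) → ℝ)
    (hnn : ∀ i S, 0 ≤ v i S)
    (hmono : ∀ i (S T : Finset (Fin m)), v i S ≤ v i (S ∪ T))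
    (hsub : ∀ i (S T : Finset (Fin m)), v i (S ∪ T) ≤ v i S + v i T)
    (b : Fin 3 → SetBid m) (i : Fin 3)
    (hbr : BestResponse PreferredItemECE (v i) b i) :
    EF1From (1 / 3) (v i) (PreferredItemECE b) i := by
  intro j hj
  set V := v i (PreferredItemECE b i) with hVdef
  set B := PreferredItemECE b j with hBdef
  have hV0 : 0 ≤ V := hnn _ _
  have hvm : Monotone (v i) := fun S U hSU => by
    have := hmono i S U
    rwa [union_eq_right.2 hSU] at this
  have hV : Bounded b i (v i) V := ⟨hvm, hbr⟩
  have h0 : v i ∅ ≤ V := hvm (empty_subset _)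
  by_cases hB : v i B ≤ V
  · obtain ⟨g, hg⟩ := hj
    refine ⟨g, hg, ?_⟩
    have h1 := hvm (erase_subset g B)
    have h2 := hnn i (B.erase g)
    linarith
  obtain ⟨⟨N, hN⟩, hsN⟩ := exists_iterate_step_eq_outcome b
  change run b N = _ at hN
  have hN1 : (run b N).1 = PreferredItemECE b := by rw [hN]
  have hN2 : (run b N).2 = ∅ := by rw [hN]
  have hc : Concentrated B (run b N) := by
    refine ⟨j, by rw [hN1], fun c hcj => ?_⟩
    have := (reach_run (b := b) (i := i) N).isPartition.disj c j hcj
    rwa [hN1] at this ⊢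
  obtain ⟨k, hkN, q, y, hR, hq, hy, hrun, hFB, hF, hO⟩ :=
    exists_first_addition (B := B) (N := N) (v := v i) (V := V)
      ⟨j, by rw [hN1], by rw [hN1]; exact not_le.1 hB⟩ h0
  set O := (run b k).1 q with hOdef
  set F := insert y O with hFdef
  have hyF : y ∈ F := mem_insert_self _ _
  have hyR : y ∈ (run b k).2 := hy ▸ preferredItem_mem _ _ _
  have hreal := reach_run (b := b) (i := i) k
  have hqi : q ≠ i := by
    rintro rfl
    rw [← priAgent_congr (envies_withBid_report (b := b) (i := q) _)] at hq
    exact absurd ((hV.le_of_pick hreal hq).2 y hyR) (not_le.2 hF)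
  set f := raise (report (b i)) F (report (b i) univ + 1) with hf
  have ht : Top f F := by
    intro S hS
    rw [hf, raise_of_not_subset hS, raise_of_subset (subset_refl F)]
    have := (report (b i)).mono (subset_univ S)
    exact lt_of_lt_of_le (by linarith) (le_max_right _ _)
  have hfY : ∀ Y, ¬ F ⊆ Y → f Y = (b i).val Y := fun Y hY => raise_of_not_subset hY
  have hreach : Reach b i f (run b (k + 1)) := by
    have hns : ∀ c, ¬ F ⊆ (run b k).1 c := fun c hFc =>
      disjoint_left.1 (hreal.isPartition.disj_rest c) (hFc hyF) hyR
    have hq' : priAgent (withBid b i f 1) (run b k).1 = some q := by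
      rw [← hq, ← priAgent_congr (envies_withBid_report (b := b) (i := i) _)]
      refine priAgent_congr (envies_withBid_congr fun c => ?_)
      rw [hfY _ (hns _), hfY _ (hns _)]
      rfl
    rw [hrun, hy]
    exact (hreal.raise hyF hyR _).other hR hq' hqi
  have hqF : (run b (k + 1)).1 q = F := by
    rw [hrun]
    simp [give, hFdef, hOdef]
  have T : Target b i (v i) V (fun S => v i (S ∩ B) ≤ V) F :=
    ⟨hV, ⟨y, hyF⟩, not_le.2 hF, fun S hS => (hvm inter_subset_left).trans hS⟩
  have hlx : ∀ Z R, Disjoint Z B → R ⊆ (run b (k + 1)).2 →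
      Lx (fun S => v i (S ∩ B) ≤ V) Z R := by
    intro Z R hZ hRR
    rw [disjoint_iff_inter_eq_empty] at hZ
    refine ⟨by change v i (Z ∩ B) ≤ V; rwa [hZ], fun x hx => ?_⟩
    change v i (insert x Z ∩ B) ≤ V
    by_cases hxB : x ∈ B
    · rw [insert_inter_of_mem hxB, hZ]
      exact hV.single_le hN2 hc (by omega) (by omega : k + 1 ≤ N) (o := q)
        (by rw [hqF]; exact ⟨y, hyF⟩) (by rwa [hqF]) hxB (hRR hx)
    · rwa [insert_inter_of_notMem hxB, hZ]
  obtain ⟨Z, Q, R, hZ, hQ, hBR, R₁, R₂, hR12, hl1, hl2⟩ :=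
    exists_splits T ht hfY hFB hN2 hc hlx (N - (k + 1)) (k + 1) (by omega) (subset_refl _) q
      hqi hqF hreach
  refine ⟨y, hFB hyF, ?_⟩
  have hcover : B.erase y ⊆ O ∪ ((Z ∪ R₁) ∩ B ∪ (Q ∪ R₂) ∩ B) := by
    intro x hx
    obtain ⟨hxy, hxB⟩ := mem_erase.1 hx
    rcases mem_union.1 (hBR hxB) with h1 | h1
    · rcases mem_insert.1 h1 with h1 | h1
      · exact absurd h1 hxy
      · exact mem_union_left _ h1
    · have := hR12 h1
      simp only [mem_union, mem_inter] at this ⊢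
      tauto
  change v i ((Z ∪ R₁) ∩ B) ≤ V at hl1
  change v i ((Q ∪ R₂) ∩ B) ≤ V at hl2
  have h1 := hvm hcover
  have h2 := hsub i O ((Z ∪ R₁) ∩ B ∪ (Q ∪ R₂) ∩ B)
  have h3 := hsub i ((Z ∪ R₁) ∩ B) ((Q ∪ R₂) ∩ B)
  linarith
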